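/- arXiv:1904.05996 — 3 statements merged into one kernel-verified Lean document; each statement's English description precedes it below -/
import Mathlib

section
/- Let p be a prime number, n ≥ 1 an integer, and A a commutative Artinian local ring with maximal ideal 𝔪 whose residue field A/𝔪 is finite of characteristic p. Then every matrix M ∈ Mₙ(A) such that all entries of M − I lie in 𝔪 is invertible; the set 1 + Mₙ(𝔪) := {M ∈ Mₙ(A) : all entries of M − I lie in 𝔪} is a finite group under matrix multiplication; and its cardinality is a power of p, i.e. there exists k ∈ ℕ with Nat.card(1 + Mₙ(𝔪)) = p^k. -/
set_option synthInstance.maxHeartbeats 1000000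
set_option maxHeartbeats 1000000

/-- An Artinian local ring with finite residue field is finite. -/
theorem IsArtinianRing.finite_of_finite_residueField
    (A : Type*) [CommRing A] [IsArtinianRing A] [IsLocalRing A]
    [Finite (IsLocalRing.ResidueField A)] : Finite A := by
  obtain ⟨k, hk⟩ := IsArtinianRing.isNilpotent_jacobson_bot (R := A)
  rw [IsLocalRing.jacobson_eq_maximalIdeal ⊥ bot_ne_top] at hk
  have : Finite (A ⧸ IsLocalRing.maximalIdeal A) :=
    inferInstanceAs (Finite (IsLocalRing.ResidueField A))
  have hfin : Finite (A ⧸ IsLocalRing.maximalIdeal A ^ k) :=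
    Ideal.finite_quotient_pow (IsNoetherian.noetherian _) k
  rw [hk] at hfin
  exact Finite.of_equiv _ (RingEquiv.quotientBot A).toEquiv

/-- Every ideal of a finite local ring whose residue characteristic is `p` has `p`-power
cardinality. -/
theorem IsLocalRing.exists_card_ideal_eq_prime_pow
    (p : ℕ) (hp : p.Prime) (A : Type*) [CommRing A] [IsLocalRing A] [Finite A]
    [CharP (IsLocalRing.ResidueField A) p] (I : Ideal A) : ∃ k : ℕ, Nat.card I = p ^ k := by
  have : Fact p.Prime := ⟨hp⟩
  have hpm : (p : A) ∈ IsLocalRing.maximalIdeal A := by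
    rw [← IsLocalRing.residue_eq_zero_iff, map_natCast, CharP.cast_eq_zero]
  obtain ⟨k, hk⟩ := IsArtinianRing.isNilpotent_jacobson_bot (R := A)
  rw [IsLocalRing.jacobson_eq_maximalIdeal ⊥ bot_ne_top] at hk
  have hpk : (p : A) ^ k = 0 := by
    have h := Ideal.pow_mem_pow hpm k
    rwa [hk] at h
  have hG : IsPGroup p (Multiplicative I) := fun g => ⟨k, by
    apply Multiplicative.toAdd.injective
    ext
    simp [hpk]⟩
  obtain ⟨j, hj⟩ := IsPGroup.iff_card.mp hG
  exact ⟨j, hj⟩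

/-- A matrix congruent to the identity modulo the maximal ideal of a local ring is
invertible. -/
theorem IsLocalRing.isUnit_of_sub_one_mem_maximalIdeal
    {A ι : Type*} [CommRing A] [IsLocalRing A] [Fintype ι] [DecidableEq ι]
    {M : Matrix ι ι A} (hM : ∀ i j, (M - 1) i j ∈ IsLocalRing.maximalIdeal A) : IsUnit M := by
  have hres : (IsLocalRing.residue A).mapMatrix M = 1 := by
    rw [← sub_eq_zero, ← map_one (IsLocalRing.residue A).mapMatrix, ← map_sub]
    ext i j
    exact (IsLocalRing.residue_eq_zero_iff _).mpr (hM i j)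
  rw [Matrix.isUnit_iff_isUnit_det]
  apply isUnit_of_map_unit (IsLocalRing.residue A)
  rw [RingHom.map_det, hres, Matrix.det_one]
  exact isUnit_one

/-- Translating by the identity identifies the matrices congruent to the identity modulo an
ideal `I` with the matrices with entries in `I`. -/
def Matrix.subOneMemEquiv {A ι : Type*} [CommRing A] [DecidableEq ι] (I : Ideal A) :
    {M : Matrix ι ι A | ∀ i j, (M - 1) i j ∈ I} ≃ (ι × ι → I) where
  toFun M ij := ⟨(M.1 - 1) ij.1 ij.2, M.2 ij.1 ij.2⟩
  invFun f := ⟨Matrix.of (fun i j => (f (i, j) : A)) + 1, fun i j => by simp⟩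
  left_inv M := by ext i j; simp
  right_inv f := by ext ij; simp

/-- Let `p` be a prime, `n ≥ 1`, and `A` a commutative Artinian local ring whose residue
field is finite of characteristic `p`.  Then every matrix `M` with `M - I` having entries in
the maximal ideal `𝔪` is invertible; the set `1 + Mₙ(𝔪)` is a finite group under matrix
multiplication; and its cardinality is a power of `p`. -/
theorem trivial_lifts_form_finite_p_group
    (p n : ℕ) (hp : p.Prime) (hn : 1 ≤ n)
    (A : Type*) [CommRing A] [IsArtinianRing A] [IsLocalRing A]
    [Finite (IsLocalRing.ResidueField A)] [CharP (IsLocalRing.ResidueField A) p]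
    (S : Set (Matrix (Fin n) (Fin n) A))
    (hS : S = {M : Matrix (Fin n) (Fin n) A |
      ∀ i j : Fin n, (M - 1) i j ∈ IsLocalRing.maximalIdeal A}) :
    (∀ M ∈ S, IsUnit M) ∧
    (1 : Matrix (Fin n) (Fin n) A) ∈ S ∧
    (∀ M ∈ S, ∀ N ∈ S, M * N ∈ S) ∧
    (∀ M ∈ S, ∃ N ∈ S, M * N = 1 ∧ N * M = 1) ∧
    S.Finite ∧
    (∃ k : ℕ, Nat.card S = p ^ k) := by
  subst hS
  have hmul : ∀ M N : Matrix (Fin n) (Fin n) A,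
      (∀ i j, (N - 1) i j ∈ IsLocalRing.maximalIdeal A) →
      ∀ i j, (M * N - M) i j ∈ IsLocalRing.maximalIdeal A := by
    intro M N hN i j
    have h : M * N - M = M * (N - 1) := by rw [mul_sub, mul_one]
    rw [h, Matrix.mul_apply]
    exact Ideal.sum_mem _ fun l _ => Ideal.mul_mem_left _ _ (hN l j)
  have hA : Finite A := IsArtinianRing.finite_of_finite_residueField A
  refine ⟨fun M hM => IsLocalRing.isUnit_of_sub_one_mem_maximalIdeal hM, by simp, ?_, ?_,
    Set.toFinite _, ?_⟩
  · intro M hM N hN i j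
    have h : M * N - 1 = (M * N - M) + (M - 1) := by abel
    rw [h]
    exact Ideal.add_mem _ (hmul M N hN i j) (hM i j)
  · intro M hM
    obtain ⟨u, rfl⟩ := IsLocalRing.isUnit_of_sub_one_mem_maximalIdeal hM
    refine ⟨(u⁻¹ : (Matrix (Fin n) (Fin n) A)ˣ), fun i j => ?_, u.mul_inv, u.inv_mul⟩
    have h := hmul (u⁻¹ : (Matrix (Fin n) (Fin n) A)ˣ) u hM i j
    rw [u.inv_mul, ← neg_sub, Matrix.neg_apply] at h
    exact (Ideal.neg_mem_iff _).mp h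
  · obtain ⟨k, hk⟩ :=
      IsLocalRing.exists_card_ideal_eq_prime_pow p hp A (IsLocalRing.maximalIdeal A)
    refine ⟨k * Nat.card (Fin n × Fin n), ?_⟩
    rw [Nat.card_congr (Matrix.subOneMemEquiv (IsLocalRing.maximalIdeal A)), Nat.card_fun, hk,
      pow_mul]
end

section
/- The ring R = S/I_rel satisfies: (i) the Krull dimension of R equals 1 + n²(d+1), and (ii) p is not a zero divisor in R; consequently R is torsion-free, hence flat, as a module over the discrete valuation ring 𝒪_L. -/
set_option synthInstance.maxHeartbeats 1000000
set_option maxHeartbeats 1000000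

open scoped Matrix

noncomputable section

/-- The ring of integers of `L`: the integral closure of `ℤ_[p]` in `L`. -/
abbrev RingOfIntegers (p : ℕ) [Fact p.Prime] (L : Type*) [Field L] [Algebra ℤ_[p] L] :=
  integralClosure ℤ_[p] L

/-- The matrix of variables `X_k` inside the multivariate power series ring. -/
def varMatrix {A : Type*} [CommRing A] (N n : ℕ) (k : Fin N) :
    Matrix (Fin n) (Fin n) (MvPowerSeries (Fin N × Fin n × Fin n) A) :=
  Matrix.of fun i j => MvPowerSeries.X (k, i, j)

/-- `X̃_k = I + X_k`. -/
def Xt {A : Type*} [CommRing A] (N n : ℕ) (k : Fin N) :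
    Matrix (Fin n) (Fin n) (MvPowerSeries (Fin N × Fin n × Fin n) A) :=
  1 + varMatrix N n k

/-- Commutator `[A, B] = A B A⁻¹ B⁻¹` of square matrices. -/
def matComm {R : Type*} [CommRing R] {n : ℕ} (A B : Matrix (Fin n) (Fin n) R) :
    Matrix (Fin n) (Fin n) R :=
  A * B * A⁻¹ * B⁻¹

/-- The Demuškin relation matrix
`X̃_1^q ⬝ [X̃_1, X̃_2] ⬝ [X̃_3, X̃_4] ⋯ [X̃_{d+1}, X̃_{d+2}]` with `d = 2m`. -/
def relMatrix {A : Type*} [CommRing A] (q m n : ℕ) :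
    Matrix (Fin n) (Fin n) (MvPowerSeries (Fin (2 * m + 2) × Fin n × Fin n) A) :=
  (Xt (2 * m + 2) n ⟨0, by omega⟩) ^ q *
    (List.ofFn (fun i : Fin (m + 1) =>
      matComm (Xt (2 * m + 2) n ⟨2 * i, by have := i.isLt; omega⟩)
        (Xt (2 * m + 2) n ⟨2 * i + 1, by have := i.isLt; omega⟩))).prod

/-- The ideal generated by the `n²` entries of the relation matrix minus the identity. -/
def relIdeal {A : Type*} [CommRing A] (q m n : ℕ) :
    Ideal (MvPowerSeries (Fin (2 * m + 2) × Fin n × Fin n) A) :=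
  Ideal.span (Set.range fun ij : Fin n × Fin n =>
    (relMatrix (A := A) q m n - 1) ij.1 ij.2)

/-- The universal framed deformation ring `R = S / I_rel`. -/
abbrev defRing {A : Type*} [CommRing A] (q m n : ℕ) :=
  MvPowerSeries (Fin (2 * m + 2) × Fin n × Fin n) A ⧸ relIdeal (A := A) q m n

section Depth

open IsLocalRing

variable {R : Type*} [CommRing R]

/-- `x` is a nonzerodivisor modulo the ideal `I`. -/
def RegularMod (I : Ideal R) (x : R) : Prop := ∀ r, x * r ∈ I → r ∈ I

/-- The quotient of a local ring `R` by `I` is nonzero and has a regular sequence of length `k`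
inside the maximal ideal. -/
def DepthGE [IsLocalRing R] : ℕ → Ideal R → Prop
  | 0, I => I ≠ ⊤
  | k + 1, I => ∃ x ∈ maximalIdeal R, RegularMod I x ∧ DepthGE k (I ⊔ Ideal.span {x})

theorem isAssociatedPrime_quotient_iff [IsNoetherianRing R] {I P : Ideal R} :
    IsAssociatedPrime P (R ⧸ I) ↔ P.IsPrime ∧ ∃ u, ∀ r, r ∈ P ↔ r * u ∈ I := by
  rw [isAssociatedPrime_iff]
  refine and_congr_right fun _ => ⟨?_, ?_⟩
  · rintro ⟨x, rfl⟩
    obtain ⟨u, rfl⟩ := Ideal.Quotient.mk_surjective x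
    refine ⟨u, fun r => ?_⟩
    rw [Submodule.mem_colon_singleton, Submodule.mem_bot, ← Ideal.Quotient.eq_zero_iff_mem,
      map_mul, Algebra.smul_def, Ideal.Quotient.algebraMap_eq]
  · rintro ⟨u, hu⟩
    refine ⟨Ideal.Quotient.mk I u, ?_⟩
    ext r
    rw [Submodule.mem_colon_singleton, Submodule.mem_bot, hu, ← Ideal.Quotient.eq_zero_iff_mem,
      map_mul, Algebra.smul_def, Ideal.Quotient.algebraMap_eq]

theorem exists_isAssociatedPrime_quotient [IsNoetherianRing R] {I : Ideal R} {w : R}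
    (hw : w ∉ I) : ∃ P, IsAssociatedPrime P (R ⧸ I) ∧ ∀ r, r * w ∈ I → r ∈ P := by
  obtain ⟨P, hP, h⟩ := exists_le_isAssociatedPrime_of_isNoetherianRing R (Ideal.Quotient.mk I w)
    (by rwa [Ne, Ideal.Quotient.eq_zero_iff_mem])
  refine ⟨P, hP, fun r hr => h ?_⟩
  rwa [Submodule.mem_colon_singleton, Submodule.mem_bot, Algebra.smul_def,
    Ideal.Quotient.algebraMap_eq, ← map_mul, Ideal.Quotient.eq_zero_iff_mem]

theorem RegularMod.notMem_of_isAssociatedPrime [IsNoetherianRing R] {I P : Ideal R} {x : R}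
    (hx : RegularMod I x) (hP : IsAssociatedPrime P (R ⧸ I)) : x ∉ P := by
  obtain ⟨hP, u, hu⟩ := isAssociatedPrime_quotient_iff.1 hP
  intro h
  refine hP.ne_top ((Ideal.eq_top_iff_one _).2 ((hu 1).2 ?_))
  rw [one_mul]
  exact hx _ ((hu x).1 h)

theorem regularMod_of_notMem [IsNoetherianRing R] {I : Ideal R} {x : R}
    (h : ∀ P, IsAssociatedPrime P (R ⧸ I) → x ∉ P) : RegularMod I x := by
  intro r hr
  by_contra hrI
  obtain ⟨P, hP, hP'⟩ := exists_isAssociatedPrime_quotient hrI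
  exact h P hP (hP' x hr)

variable [IsLocalRing R] [IsNoetherianRing R]

theorem le_of_le_sup_mul_span {I J : Ideal R} {x : R} (hx : x ∈ maximalIdeal R)
    (h : ∀ r ∈ J, ∃ s ∈ J, r - x * s ∈ I) : J ≤ I := by
  refine Submodule.le_of_le_smul_of_le_jacobson_bot (I := maximalIdeal R)
    (IsNoetherian.noetherian J) (IsLocalRing.maximalIdeal_le_jacobson _) ?_
  intro r hr
  obtain ⟨s, hs, h⟩ := h r hr
  have : r = (r - x * s) + x * s := by ring
  rw [this]
  exact Submodule.add_mem_sup h (Submodule.smul_mem_smul hx hs)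

theorem mem_sup_span_singleton_iff {R : Type*} [CommRing R] {I : Ideal R} {x r : R} :
    r ∈ I ⊔ Ideal.span {x} ↔ ∃ s, r - x * s ∈ I := by
  rw [sup_comm, Ideal.mem_span_singleton_sup]
  constructor
  · rintro ⟨a, b, hb, rfl⟩
    exact ⟨a, by simpa [mul_comm] using hb⟩
  · rintro ⟨s, hs⟩
    exact ⟨s, _, hs, by ring⟩

theorem exists_isAssociatedPrime_gt {I P : Ideal R} {x : R} (hx : x ∈ maximalIdeal R)
    (hreg : RegularMod I x) (hP : IsAssociatedPrime P (R ⧸ I)) :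
    ∃ Q, IsAssociatedPrime Q (R ⧸ (I ⊔ Ideal.span {x})) ∧ P < Q := by
  have hxP := hreg.notMem_of_isAssociatedPrime hP
  obtain ⟨hP, u, hu⟩ := isAssociatedPrime_quotient_iff.1 hP
  let J : Ideal R := Submodule.colon I (P : Set R)
  have hJ : ∀ r, r ∈ J ↔ ∀ s ∈ P, r * s ∈ I := fun r => Submodule.mem_colon
  have huJ : u ∈ J := (hJ u).2 fun s hs => by rw [mul_comm]; exact (hu s).1 hs
  have huI : u ∉ I := fun h => hP.ne_top ((Ideal.eq_top_iff_one _).2 ((hu 1).2 (by rwa [one_mul])))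
  have : ∃ w ∈ J, w ∉ I ⊔ Ideal.span {x} := by
    by_contra! hcon
    refine huI (le_of_le_sup_mul_span hx (fun r hr => ?_) huJ)
    obtain ⟨s, hs⟩ := mem_sup_span_singleton_iff.1 (hcon r hr)
    refine ⟨s, (hJ s).2 fun t ht => hreg _ ?_, hs⟩
    have h1 := (hJ r).1 hr t ht
    have h2 := I.mul_mem_right t hs
    have : x * (s * t) = r * t - (r - x * s) * t := by ring
    rw [this]
    exact I.sub_mem h1 h2
  obtain ⟨w, hwJ, hw⟩ := this
  obtain ⟨Q, hQ, hQ'⟩ := exists_isAssociatedPrime_quotient hw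
  have hle : P ≤ Q := fun r hr => hQ' r (le_sup_left (a := I) (by
    rw [mul_comm]; exact (hJ w).1 hwJ r hr))
  have hxQ : x ∈ Q := hQ' x (mem_sup_span_singleton_iff.2 ⟨w, by simp⟩)
  exact ⟨Q, hQ, lt_of_le_of_ne hle fun h => hxP (h ▸ hxQ)⟩

theorem DepthGE.le_coheight {k : ℕ} : ∀ {I : Ideal R}, DepthGE k I →
    ∀ P : PrimeSpectrum R, IsAssociatedPrime P.asIdeal (R ⧸ I) → (k : ℕ∞) ≤ Order.coheight P := by
  induction k with
  | zero => intros; simp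
  | succ k ih =>
    rintro I ⟨x, hx, hreg, h⟩ P hP
    obtain ⟨Q, hQ, hlt⟩ := exists_isAssociatedPrime_gt hx hreg hP
    let Q' : PrimeSpectrum R := ⟨Q, hQ.isPrime⟩
    have h1 := ih h Q' hQ
    have h2 : Order.coheight Q' + 1 ≤ Order.coheight P :=
      Order.coheight_add_one_le (show P < Q' from hlt)
    push_cast
    exact (add_le_add_left h1 1).trans h2

theorem DepthGE.ne_top {R : Type*} [CommRing R] [IsLocalRing R] {k : ℕ} {I : Ideal R}
    (h : DepthGE k I) : I ≠ ⊤ := by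
  induction k generalizing I with
  | zero => exact h
  | succ k ih =>
    obtain ⟨x, -, -, h⟩ := h
    exact fun hI => ih h (by simp [hI])

theorem exists_regularMod_pair {I J : Ideal R}
    (hI : ∃ x ∈ maximalIdeal R, RegularMod I x) (hJ : ∃ x ∈ maximalIdeal R, RegularMod J x) :
    ∃ x ∈ maximalIdeal R, RegularMod I x ∧ RegularMod J x := by
  by_contra! hcon
  have hfin := (associatedPrimes.finite R (R ⧸ I)).union (associatedPrimes.finite R (R ⧸ J))
  have key := (Ideal.subset_union_prime (s := hfin.toFinset) (f := id) (I := maximalIdeal R) ⊤ ⊤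
    (fun P hP _ _ => by
      rcases (Set.Finite.mem_toFinset hfin).1 hP with h | h
      exacts [h.isPrime, h.isPrime])).1 (by
      intro x hx
      simp only [Set.Finite.coe_toFinset, Set.mem_iUnion, SetLike.mem_coe, id]
      by_contra! hx'
      exact hcon x hx (regularMod_of_notMem fun P hP => hx' P (Or.inl hP))
        (regularMod_of_notMem fun P hP => hx' P (Or.inr hP)))
  obtain ⟨P, hP, hle⟩ := key
  rcases (Set.Finite.mem_toFinset hfin).1 hP with h | h
  · obtain ⟨x, hx, hreg⟩ := hI
    exact hreg.notMem_of_isAssociatedPrime h (hle hx)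
  · obtain ⟨x, hx, hreg⟩ := hJ
    exact hreg.notMem_of_isAssociatedPrime h (hle hx)

theorem exists_mul_mem_of_forall_not_regularMod {I : Ideal R}
    (h : ¬ ∃ x ∈ maximalIdeal R, RegularMod I x) : ∃ w ∉ I, ∀ r ∈ maximalIdeal R, r * w ∈ I := by
  have hfin := associatedPrimes.finite R (R ⧸ I)
  obtain ⟨P, hP, hle⟩ := (Ideal.subset_union_prime (s := hfin.toFinset) (f := id)
    (I := maximalIdeal R) ⊤ ⊤
    (fun P hP _ _ => ((Set.Finite.mem_toFinset hfin).1 hP).isPrime)).1 (by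
      intro x hx
      simp only [Set.Finite.coe_toFinset, Set.mem_iUnion, SetLike.mem_coe, id]
      by_contra! hx'
      exact h ⟨x, hx, regularMod_of_notMem hx'⟩)
  obtain ⟨hP, u, hu⟩ := isAssociatedPrime_quotient_iff.1 ((Set.Finite.mem_toFinset hfin).1 hP)
  exact ⟨u, fun h => hP.ne_top ((Ideal.eq_top_iff_one _).2 ((hu 1).2 (by rwa [one_mul]))),
    fun r hr => (hu r).1 (hle hr)⟩

theorem RegularMod.swap {R : Type*} [CommRing R] {I : Ideal R} {a c : R}
    (hca : RegularMod (I ⊔ Ideal.span {a}) c) (ha : RegularMod I a) :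
    RegularMod (I ⊔ Ideal.span {c}) a := by
  intro r hr
  obtain ⟨s, hs⟩ := mem_sup_span_singleton_iff.1 hr
  obtain ⟨t, ht⟩ := mem_sup_span_singleton_iff.1 (hca s (mem_sup_span_singleton_iff.2
    ⟨r, by simpa using I.neg_mem hs⟩))
  refine mem_sup_span_singleton_iff.2 ⟨t, ha _ ?_⟩
  have : a * (r - c * t) = (a * r - c * s) + c * (s - a * t) := by ring
  rw [this]
  exact I.add_mem hs (I.mul_mem_left _ ht)

theorem exists_regularMod_sup {I : Ideal R} {a b : R} (ha : RegularMod I a)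
    (hb : RegularMod I b) (ham : a ∈ maximalIdeal R)
    (h : ∃ c ∈ maximalIdeal R, RegularMod (I ⊔ Ideal.span {a}) c) :
    ∃ c ∈ maximalIdeal R, RegularMod (I ⊔ Ideal.span {b}) c := by
  by_contra hcon
  obtain ⟨w, hw, hmw⟩ := exists_mul_mem_of_forall_not_regularMod hcon
  obtain ⟨c, hc, hreg⟩ := h
  obtain ⟨u, hu⟩ := mem_sup_span_singleton_iff.1 (hmw a ham)
  have huI : u ∈ I ⊔ Ideal.span {a} := by
    refine hreg u (mem_sup_span_singleton_iff.2 ?_)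
    obtain ⟨s, hs⟩ := mem_sup_span_singleton_iff.1 (hmw c hc)
    refine ⟨s, hb _ ?_⟩
    have : b * (c * u - a * s) = a * (c * w - b * s) - c * (a * w - b * u) := by ring
    rw [this]
    exact I.sub_mem (I.mul_mem_left _ hs) (I.mul_mem_left _ hu)
  obtain ⟨t, ht⟩ := mem_sup_span_singleton_iff.1 huI
  refine hw (mem_sup_span_singleton_iff.2 ⟨t, ha _ ?_⟩)
  have : a * (w - b * t) = (a * w - b * u) + b * (u - a * t) := by ring
  rw [this]
  exact I.add_mem hu (I.mul_mem_left _ ht)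

theorem DepthGE.exchange {k : ℕ} : ∀ {I : Ideal R} {a b : R}, a ∈ maximalIdeal R →
    b ∈ maximalIdeal R → RegularMod I a → RegularMod I b → DepthGE k (I ⊔ Ideal.span {a}) →
    DepthGE k (I ⊔ Ideal.span {b}) := by
  induction k with
  | zero =>
    intro I a b ham hbm ha hb h hI
    have hIm : I ≤ maximalIdeal R := le_maximalIdeal fun hI => h (by simp [hI])
    refine (maximalIdeal.isMaximal R).ne_top (top_le_iff.1 (hI ▸ sup_le hIm ?_))
    rwa [Ideal.span_singleton_le_iff_mem]
  | succ k ih =>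
    rintro I a b ham hbm ha hb ⟨c, hc, hreg, h⟩
    obtain ⟨e, he, hea, heb⟩ := exists_regularMod_pair ⟨c, hc, hreg⟩
      (exists_regularMod_sup ha hb ham ⟨c, hc, hreg⟩)
    have h1 := ih hc he hreg hea h
    rw [sup_right_comm] at h1
    have h2 := ih ham hbm (hea.swap ha) (heb.swap hb) h1
    rw [sup_right_comm] at h2
    exact ⟨e, he, heb, h2⟩

theorem DepthGE.of_regularMod {k : ℕ} {I : Ideal R} {x : R} (h : DepthGE (k + 1) I)
    (hx : x ∈ maximalIdeal R) (hreg : RegularMod I x) : DepthGE k (I ⊔ Ideal.span {x}) := by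
  obtain ⟨y, hy, hreg', h⟩ := h
  exact h.exchange hy hx hreg' hreg

theorem ringKrullDim_quotient_le_length {I : Ideal R} {l : List R}
    (hl : ∀ x ∈ l, x ∈ maximalIdeal R)
    (h : ∀ Q : Ideal R, Q.IsPrime → I ≤ Q → (∀ x ∈ l, x ∈ Q) → Q = maximalIdeal R) :
    ringKrullDim (R ⧸ I) ≤ l.length := by
  classical
  by_cases hI : I = ⊤
  · have : Subsingleton (R ⧸ I) := Ideal.Quotient.subsingleton_iff.2 hI
    rw [ringKrullDim_eq_bot_of_subsingleton]
    exact bot_le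
  have : Nontrivial (R ⧸ I) := Ideal.Quotient.nontrivial_iff.2 hI
  have hsurj : Function.Surjective (Ideal.Quotient.mk I) := Ideal.Quotient.mk_surjective
  have : IsLocalRing (R ⧸ I) := .of_surjective' _ hsurj
  have hloc : IsLocalHom (Ideal.Quotient.mk I) := hsurj.isLocalHom _
  have hmax : ∀ x, x ∈ maximalIdeal R → Ideal.Quotient.mk I x ∈ maximalIdeal (R ⧸ I) := fun x hx =>
    (map_mem_nonunits_iff (Ideal.Quotient.mk I) x).2 hx
  rw [← maximalIdeal_height_eq_ringKrullDim]
  refine WithBot.coe_le_coe.2 ?_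
  let s : Finset (R ⧸ I) := (l.map (Ideal.Quotient.mk I)).toFinset
  refine (Ideal.height_le_card_of_mem_minimalPrimes_span_finset (s := s) ?_).trans ?_
  · refine ⟨⟨inferInstance, Ideal.span_le.2 fun x hx => ?_⟩, ?_⟩
    · simp only [s, List.coe_toFinset, List.mem_map, Set.mem_ofPred_eq] at hx
      obtain ⟨y, hy, rfl⟩ := hx
      exact hmax y (hl y hy)
    · rintro Q ⟨hQ, hsQ⟩ -
      have hcomap := h (Q.comap (Ideal.Quotient.mk I)) inferInstance
        (fun x hx => by simp [Ideal.mem_comap, Ideal.Quotient.eq_zero_iff_mem.2 hx])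
        (fun x hx => hsQ (Ideal.subset_span (by
          simp only [s, List.coe_toFinset, List.mem_map, Set.mem_ofPred_eq]
          exact ⟨x, hx, rfl⟩)))
      intro z hz
      obtain ⟨x, rfl⟩ := hsurj z
      have : x ∈ Q.comap (Ideal.Quotient.mk I) := hcomap ▸ (map_mem_nonunits_iff _ x).1 hz
      exact this
  · exact_mod_cast (List.toFinset_card_le _).trans (by simp)

theorem coe_coheight_eq_ringKrullDim_quotient {R : Type*} [CommRing R] (P : PrimeSpectrum R) :
    (Order.coheight P : WithBot ℕ∞) = ringKrullDim (R ⧸ P.asIdeal) := by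
  rw [Order.coheight_eq_krullDim_Ici, ringKrullDim_quotient]
  rfl

/-- A system of parameters in a quotient of maximal depth is a regular sequence. -/
theorem DepthGE.regularMod_of_forall_prime {x : R} {l : List R} {I : Ideal R}
    (hI : DepthGE (l.length + 1) I) (hl : ∀ y ∈ l, y ∈ maximalIdeal R)
    (h : ∀ Q : Ideal R, Q.IsPrime → I ≤ Q → x ∈ Q → (∀ x ∈ l, x ∈ Q) → Q = maximalIdeal R) :
    RegularMod I x := by
  refine regularMod_of_notMem fun P hP hxP => ?_
  have h1 := hI.le_coheight ⟨P, hP.isPrime⟩ hP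
  have hIP : I ≤ P := by
    obtain ⟨-, u, hu⟩ := isAssociatedPrime_quotient_iff.1 hP
    exact fun r hr => (hu r).2 (I.mul_mem_right _ hr)
  have h2 := ringKrullDim_quotient_le_length (I := P) hl
    fun Q hQ hPQ hlQ => h Q hQ (hIP.trans hPQ) (hPQ hxP) hlQ
  rw [← coe_coheight_eq_ringKrullDim_quotient ⟨P, hP.isPrime⟩] at h2
  have := (WithBot.coe_le_coe.2 h1).trans h2
  norm_cast at this
  omega

theorem DepthGE.sup_span_of_forall_prime (l l' : List R) : ∀ {I : Ideal R},
    DepthGE (l ++ l').length I → (∀ y ∈ l ++ l', y ∈ maximalIdeal R) →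
    (∀ Q : Ideal R, Q.IsPrime → I ≤ Q → (∀ x ∈ l ++ l', x ∈ Q) → Q = maximalIdeal R) →
    DepthGE l'.length (I ⊔ Ideal.span {x | x ∈ l}) := by
  induction l with
  | nil => intro I h _ _; simpa using h
  | cons x l ih =>
    intro I h hm hQ
    simp only [List.cons_append, List.length_cons, List.mem_cons, forall_eq_or_imp] at h hm hQ
    have hreg := h.regularMod_of_forall_prime hm.2
      fun Q hQ' hIQ hx hl => hQ Q hQ' hIQ ⟨hx, hl⟩
    have := ih (h.of_regularMod hm.1 hreg) hm.2 fun Q hQ' hIQ hl => hQ Q hQ' (le_sup_left.trans hIQ)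
      ⟨hIQ (le_sup_right (a := I) (Ideal.mem_span_singleton_self x)), hl⟩
    rw [sup_assoc, ← Ideal.span_union] at this
    convert this using 3
    ext y; simp

theorem DepthGE.le_ringKrullDim_quotient {k : ℕ} {I : Ideal R} (h : DepthGE k I) :
    (k : WithBot ℕ∞) ≤ ringKrullDim (R ⧸ I) := by
  obtain ⟨P, hP, -⟩ := exists_isAssociatedPrime_quotient (I := I) (w := 1)
    ((Ideal.ne_top_iff_one I).1 h.ne_top)
  have h1 := h.le_coheight ⟨P, hP.isPrime⟩ hP
  have hIP : I ≤ P := by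
    obtain ⟨-, u, hu⟩ := isAssociatedPrime_quotient_iff.1 hP
    exact fun r hr => (hu r).2 (I.mul_mem_right _ hr)
  have h2 := ringKrullDim_le_of_surjective (Ideal.Quotient.factor hIP)
    (Ideal.Quotient.factor_surjective hIP)
  rw [← coe_coheight_eq_ringKrullDim_quotient ⟨P, hP.isPrime⟩] at h2
  exact (WithBot.coe_le_coe.2 h1).trans h2

/-- Let `f`, `x`, `y` form a full system of parameters of a local ring of depth at least their total
number. Then the quotient by `f` has the expected dimension and `x` is regular on it. -/
theorem ringKrullDim_quotient_eq_and_regularMod_of_forall_prime {f y : List R} {x : R}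
    (hR : DepthGE (f ++ x :: y).length (⊥ : Ideal R))
    (hm : ∀ z ∈ f ++ x :: y, z ∈ maximalIdeal R)
    (h : ∀ Q : Ideal R, Q.IsPrime → (∀ z ∈ f ++ x :: y, z ∈ Q) → Q = maximalIdeal R) :
    ringKrullDim (R ⧸ Ideal.span {z | z ∈ f}) = (y.length + 1 : ℕ) ∧
      RegularMod (Ideal.span {z | z ∈ f}) x := by
  have hd := hR.sup_span_of_forall_prime f (x :: y) hm fun Q hQ _ => h Q hQ
  rw [bot_sup_eq] at hd
  have hQ : ∀ Q : Ideal R, Q.IsPrime → Ideal.span {z | z ∈ f} ≤ Q → (∀ z ∈ x :: y, z ∈ Q) →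
      Q = maximalIdeal R := fun Q hQ hf hxy => h Q hQ fun z hz => by
    rcases List.mem_append.1 hz with hz | hz
    exacts [hf (Ideal.subset_span hz), hxy z hz]
  have hm' : ∀ z ∈ x :: y, z ∈ maximalIdeal R := fun z hz => hm z (List.mem_append_right _ hz)
  refine ⟨le_antisymm (ringKrullDim_quotient_le_length hm' hQ) hd.le_ringKrullDim_quotient, ?_⟩
  refine hd.regularMod_of_forall_prime (fun z hz => hm' _ (by simp [hz]))
    fun Q hQ' hf hx hy => hQ Q hQ' hf (by simpa using ⟨hx, hy⟩)

end Depth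

section PowerSeriesDepth

open IsLocalRing MvPowerSeries

variable {σ A : Type*} [CommRing A]

/-- The ideal of power series all of whose monomials involve some variable `X i` with `i ∈ s`. -/
def varIdeal (s : Set σ) : Ideal (MvPowerSeries σ A) where
  carrier := {f | ∀ m : σ →₀ ℕ, (∀ i ∈ s, m i = 0) → coeff m f = 0}
  add_mem' hf hg m hm := by rw [map_add, hf m hm, hg m hm, add_zero]
  zero_mem' m _ := by simp
  smul_mem' c f hf m hm := by
    classical
    rw [smul_eq_mul, coeff_mul]
    refine Finset.sum_eq_zero fun x hx => ?_
    rw [Finset.HasAntidiagonal.mem_antidiagonal] at hx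
    rw [hf x.2, mul_zero]
    intro i hi
    have := hm i hi
    rw [← hx, Finsupp.add_apply] at this
    omega

theorem varIdeal_empty : varIdeal (A := A) (∅ : Set σ) = ⊥ := by
  refine eq_bot_iff.2 fun f hf => ?_
  rw [Ideal.mem_bot]
  ext m
  simpa using hf m (by simp)

theorem varIdeal_insert (s : Set σ) (i : σ) :
    varIdeal (A := A) (insert i s) = varIdeal s ⊔ Ideal.span {X i} := by
  classical
  refine le_antisymm (fun f hf => ?_) (sup_le (fun f hf m hm => ?_) ?_)
  · let g : MvPowerSeries σ A := fun m => if m i = 0 then coeff m f else 0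
    have hg : ∀ m, coeff m g = if m i = 0 then coeff m f else 0 := fun m => rfl
    obtain ⟨h, hh⟩ : X i ∣ f - g := X_dvd_iff.2 fun m hm => by
      rw [map_sub, hg, if_pos hm, sub_self]
    refine mem_sup_span_singleton_iff.2 ⟨h, ?_⟩
    rw [← hh, sub_sub_cancel]
    intro m hm
    rw [hg]
    split_ifs with h0
    · refine hf m fun j hj => ?_
      rcases Set.mem_insert_iff.1 hj with rfl | hj
      exacts [h0, hm j hj]
    · rfl
  · exact hf m fun j hj => hm j (Set.mem_insert_of_mem _ hj)
  · rw [Ideal.span_singleton_le_iff_mem]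
    intro m hm
    exact X_dvd_iff.1 dvd_rfl m (hm i (Set.mem_insert _ _))

theorem regularMod_varIdeal_X {s : Set σ} {i : σ} (hi : i ∉ s) :
    RegularMod (varIdeal (A := A) s) (X i) := by
  intro f hf m hm
  have := hf (Finsupp.single i 1 + m) fun j hj => by
    have : i ≠ j := fun h => hi (h ▸ hj)
    simp [hm j hj, Finsupp.single_eq_of_ne' this]
  rwa [X_def, coeff_add_monomial_mul, one_mul] at this

variable [IsLocalRing A]

theorem mem_maximalIdeal_iff_constantCoeff {f : MvPowerSeries σ A} :
    f ∈ maximalIdeal (MvPowerSeries σ A) ↔ constantCoeff f ∈ maximalIdeal A := by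
  rw [mem_maximalIdeal, mem_maximalIdeal, mem_nonunits_iff, mem_nonunits_iff,
    isUnit_iff_constantCoeff]

theorem varIdeal_le_maximalIdeal (s : Set σ) :
    varIdeal s ≤ maximalIdeal (MvPowerSeries σ A) := by
  intro f hf
  rw [mem_maximalIdeal_iff_constantCoeff, ← coeff_zero_eq_constantCoeff_apply, hf 0 (by simp)]
  exact zero_mem _

theorem depthGE_varIdeal [Finite σ] {ϖ : A} (hϖ : ϖ ∈ maximalIdeal A)
    (hϖ' : ϖ ∈ nonZeroDivisors A) (k : ℕ) : ∀ s : Set σ, sᶜ.ncard = k →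
    DepthGE (k + 1) (varIdeal (A := A) s) := by
  have hC : C ϖ ∈ maximalIdeal (MvPowerSeries σ A) := by
    rwa [mem_maximalIdeal_iff_constantCoeff, constantCoeff_C]
  induction k with
  | zero =>
    intro s hs
    refine ⟨C ϖ, hC, fun f hf m hm => ?_, fun h => ?_⟩
    · have := hf m hm
      rw [coeff_C_mul] at this
      exact (mem_nonZeroDivisors_iff.1 hϖ').1 _ this
    · refine (maximalIdeal.isMaximal (MvPowerSeries σ A)).ne_top (top_le_iff.1 (h ▸ ?_))
      exact sup_le (varIdeal_le_maximalIdeal s) ((Ideal.span_singleton_le_iff_mem _).2 hC)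
  | succ k ih =>
    intro s hs
    obtain ⟨i, hi⟩ : sᶜ.Nonempty := Set.nonempty_of_ncard_ne_zero (by omega)
    refine ⟨X i, ?_, regularMod_varIdeal_X hi, ?_⟩
    · rw [mem_maximalIdeal_iff_constantCoeff, constantCoeff_X]
      exact zero_mem _
    · rw [← varIdeal_insert]
      refine ih _ ?_
      have h1 : (insert i s)ᶜ = sᶜ \ {i} := by ext; simp [and_comm]
      rw [h1, Set.ncard_sdiff_singleton_of_mem hi, hs, Nat.add_sub_cancel]

theorem depthGE_bot_mvPowerSeries [Finite σ] {ϖ : A} (hϖ : ϖ ∈ maximalIdeal A)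
    (hϖ' : ϖ ∈ nonZeroDivisors A) :
    DepthGE (Nat.card σ + 1) (⊥ : Ideal (MvPowerSeries σ A)) := by
  rw [← varIdeal_empty]
  exact depthGE_varIdeal hϖ hϖ' _ _ (by rw [Set.compl_empty, Set.ncard_univ])

theorem eq_maximalIdeal_of_forall_X_mem [Finite σ] {ϖ : A} (hϖ : maximalIdeal A = Ideal.span {ϖ})
    {Q : Ideal (MvPowerSeries σ A)} (hQ : Q.IsPrime) (hC : C ϖ ∈ Q) (hX : ∀ i, X i ∈ Q) :
    Q = maximalIdeal (MvPowerSeries σ A) := by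
  have key : ∀ s : Set σ, s.Finite → varIdeal (A := A) s ≤ Q := fun s hs => by
    induction s, hs using Set.Finite.induction_on with
    | empty => simp [varIdeal_empty]
    | insert _ _ ih =>
      rw [varIdeal_insert]
      exact sup_le ih ((Ideal.span_singleton_le_iff_mem _).2 (hX _))
  refine le_antisymm (le_maximalIdeal hQ.ne_top) fun f hf => ?_
  rw [mem_maximalIdeal_iff_constantCoeff, hϖ, Ideal.mem_span_singleton] at hf
  obtain ⟨c, hc⟩ := hf
  have h1 : f - C (constantCoeff f) ∈ Q := by
    refine key Set.univ Set.finite_univ fun m hm => ?_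
    have : m = 0 := by ext i; exact hm i trivial
    rw [this, map_sub, coeff_zero_C, coeff_zero_eq_constantCoeff_apply, sub_self]
  have : f = (f - C (constantCoeff f)) + C ϖ * C c := by rw [hc, map_mul]; ring
  rw [this]
  exact Q.add_mem h1 (Q.mul_mem_right _ hC)

end PowerSeriesDepth

section RingOfIntegers

open IsLocalRing

variable (p : ℕ) [Fact p.Prime] (L : Type*) [Field L] [Algebra ℚ_[p] L]
  [FiniteDimensional ℚ_[p] L] [Algebra ℤ_[p] L] [IsScalarTower ℤ_[p] ℚ_[p] L]

theorem isIntegral_padicInt_iff_spectralNorm_le_one (x : L) :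
    IsIntegral ℤ_[p] x ↔ spectralNorm ℚ_[p] L x ≤ 1 := by
  have hx : IsIntegral ℚ_[p] x := Algebra.IsIntegral.isIntegral x
  have hmonic := minpoly.monic hx
  rw [spectralNorm, spectralValue_le_one_iff hmonic]
  constructor
  · intro h n
    rw [minpoly.isIntegrallyClosed_eq_field_fractions' ℚ_[p] h, Polynomial.coeff_map]
    exact PadicInt.norm_le_one _
  · intro h
    have hlift : minpoly ℚ_[p] x ∈ Polynomial.lifts (algebraMap ℤ_[p] ℚ_[p]) := by
      rw [Polynomial.lifts_iff_coeff_lifts]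
      exact fun n => ⟨⟨_, h n⟩, rfl⟩
    obtain ⟨P, hP, -, hPm⟩ := Polynomial.lifts_and_natDegree_eq_and_monic hlift hmonic
    refine ⟨P, hPm, ?_⟩
    rw [IsScalarTower.algebraMap_eq ℤ_[p] ℚ_[p] L, ← Polynomial.eval₂_map, hP]
    exact minpoly.aeval ℚ_[p] x

theorem spectralNorm_lt_one_of_not_isUnit {x : RingOfIntegers p L} (hx : ¬ IsUnit x) :
    spectralNorm ℚ_[p] L x < 1 := by
  refine lt_of_le_of_ne ((isIntegral_padicInt_iff_spectralNorm_le_one p L _).1 x.2) fun h => hx ?_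
  have hx0 : (x : L) ≠ 0 := by
    intro h0
    rw [h0, spectralNorm_zero] at h
    exact zero_ne_one h
  have hmul := spectralAlgNorm_mul (K := ℚ_[p]) (x : L) (x : L)⁻¹
  rw [mul_inv_cancel₀ hx0, spectralAlgNorm_def, spectralAlgNorm_def, spectralAlgNorm_def,
    spectralNorm_one, h, one_mul] at hmul
  exact IsUnit.of_mul_eq_one
    (⟨(x : L)⁻¹, (isIntegral_padicInt_iff_spectralNorm_le_one p L _).2 hmul.ge⟩ :
      RingOfIntegers p L) (Subtype.ext (mul_inv_cancel₀ hx0))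

theorem not_isUnit_of_spectralNorm_lt_one {x : RingOfIntegers p L}
    (hx : spectralNorm ℚ_[p] L x < 1) : ¬ IsUnit x := by
  rintro ⟨u, rfl⟩
  have hmul := spectralAlgNorm_mul (K := ℚ_[p]) ((u : RingOfIntegers p L) : L)
    ((u⁻¹ : (RingOfIntegers p L)ˣ) : RingOfIntegers p L)
  rw [← MulMemClass.coe_mul, Units.mul_inv, OneMemClass.coe_one, spectralAlgNorm_def,
    spectralAlgNorm_def, spectralAlgNorm_def, spectralNorm_one] at hmul
  have h1 := (isIntegral_padicInt_iff_spectralNorm_le_one p L _).1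
    ((u⁻¹ : (RingOfIntegers p L)ˣ) : RingOfIntegers p L).2
  exact absurd (mul_lt_one_of_nonneg_of_lt_one_left (spectralNorm_nonneg _) hx h1) hmul.not_gt

theorem isLocalRing_ringOfIntegers : IsLocalRing (RingOfIntegers p L) := by
  refine .of_nonunits_add fun a b ha hb => not_isUnit_of_spectralNorm_lt_one p L ?_
  exact (isNonarchimedean_spectralNorm (K := ℚ_[p]) (a : L) b).trans_lt (max_lt
    (spectralNorm_lt_one_of_not_isUnit p L ha) (spectralNorm_lt_one_of_not_isUnit p L hb))

theorem isDedekindDomain_ringOfIntegers : IsDedekindDomain (RingOfIntegers p L) :=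
  integralClosure.isDedekindDomain ℤ_[p] ℚ_[p] L

theorem isPrincipalIdealRing_ringOfIntegers : IsPrincipalIdealRing (RingOfIntegers p L) := by
  have := isLocalRing_ringOfIntegers p L
  have := isDedekindDomain_ringOfIntegers p L
  infer_instance

theorem natCast_prime_mem_maximalIdeal_ringOfIntegers [IsLocalRing (RingOfIntegers p L)] :
    (p : RingOfIntegers p L) ∈ maximalIdeal (RingOfIntegers p L) := by
  refine not_isUnit_of_spectralNorm_lt_one p L ?_
  have : ((p : RingOfIntegers p L) : L) = algebraMap ℚ_[p] L p := by simp
  rw [this, spectralNorm_extends]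
  exact Padic.norm_p_lt_one

end RingOfIntegers

section WeightedDomination

variable {ι Γ₀ : Type*} [LinearOrderedCommGroupWithZero Γ₀]

/-- If every nonzero value `f x` has a partner `f y` of proportional size such that `f x * f y` is
dominated by a product of values of larger total weight, then all values vanish. -/
theorem eq_zero_of_forall_exists_partner [Finite ι] {f : ι → Γ₀} {w : ι → ℕ} (hw : ∀ x, 0 < w x)
    (hf : ∀ x, f x < 1)
    (h : ∀ x, f x = 0 ∨ ∃ y, f x ^ w y = f y ^ w x ∧
      ∃ l : List ι, w x + w y < (l.map w).sum ∧ f x * f y ≤ (l.map f).prod) (x : ι) : f x = 0 := by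
  classical
  cases nonempty_fintype ι
  let W := ∏ i, w i
  have hW : 0 < W := Finset.prod_pos fun i _ => hw i
  have he : ∀ i, W / w i * w i = W := fun i =>
    Nat.div_mul_cancel (Finset.dvd_prod_of_mem w (Finset.mem_univ i))
  have he0 : ∀ i, W / w i ≠ 0 := fun i h0 => by
    have := he i
    rw [h0, zero_mul] at this
    omega
  have : Nonempty ι := ⟨x⟩
  obtain ⟨x₀, hx₀⟩ := Finite.exists_max fun i => f i ^ (W / w i)
  set M := f x₀ ^ (W / w x₀) with hM
  have hle : ∀ i, f i ^ W ≤ M ^ w i := fun i => by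
    rw [← he i, pow_mul]
    exact pow_le_pow_left₀ zero_le (hx₀ i) _
  have hle' : ∀ l : List ι, (l.map f).prod ^ W ≤ M ^ (l.map w).sum := fun l => by
    induction l with
    | nil => simp
    | cons i l ih =>
      simp only [List.map_cons, List.prod_cons, List.sum_cons, mul_pow, pow_add]
      exact mul_le_mul' (hle i) ih
  suffices hx0 : f x₀ = 0 by
    have := hx₀ x
    simp only [hM, hx0, zero_pow (he0 x₀), le_zero_iff] at this
    exact eq_zero_of_pow_eq_zero this
  rcases h x₀ with h0 | ⟨y, hy, l, hl, hxy⟩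
  · exact h0
  by_contra hne
  have hM0 : 0 < M := pow_pos (zero_lt_iff.2 hne) _
  have hM1 : M < 1 := pow_lt_one₀ zero_le (hf x₀) (he0 x₀)
  have hfx : f x₀ ^ W = M ^ w x₀ := by rw [hM, ← pow_mul, he]
  have hfy : f y ^ W = M ^ w y := by
    refine (pow_left_inj₀ zero_le zero_le (hw x₀).ne').1 ?_
    rw [pow_right_comm, ← hy, pow_right_comm, hfx, pow_right_comm]
  have h1 : M ^ (w x₀ + w y) ≤ M ^ (l.map w).sum := by
    rw [pow_add, ← hfx, ← hfy, ← mul_pow]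
    exact (pow_le_pow_left₀ zero_le hxy W).trans (hle' l)
  exact absurd h1 (pow_lt_pow_right_of_lt_one₀ hM0 hM1 hl).not_ge

end WeightedDomination

section MatrixExpansion

variable {R : Type*} [CommRing R] {n : ℕ}

theorem matComm_one_add_smul (e : R) (C D : Matrix (Fin n) (Fin n) R)
    (hC : IsUnit (1 + e • C).det) (hD : IsUnit (1 + e • D).det) :
    ∃ G, matComm (1 + e • C) (1 + e • D) = 1 + e ^ 2 • (C * D - D * C) + e ^ 3 • G := by
  set X := 1 + e • C with hX
  set Y := 1 + e • D with hY
  set U := X⁻¹ * Y⁻¹ with hU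
  have h1 : Y * X * U = 1 := by
    rw [hU, mul_assoc, ← mul_assoc X, Matrix.mul_nonsing_inv _ hC, one_mul,
      Matrix.mul_nonsing_inv _ hD]
  have h2 : U = 1 - e • ((C + D + e • (D * C)) * U) := by
    rw [eq_sub_iff_add_eq, ← h1, hX, hY]
    simp only [add_mul, mul_add, one_mul, mul_one, smul_add, smul_mul_assoc, mul_smul_comm]
    abel
  have h3 : X * Y = Y * X + e ^ 2 • (C * D - D * C) := by
    rw [hX, hY]
    simp only [add_mul, mul_add, one_mul, mul_one, smul_add, smul_mul_assoc, mul_smul_comm,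
      smul_sub, pow_two, mul_smul]
    abel
  refine ⟨-((C * D - D * C) * ((C + D + e • (D * C)) * U)), ?_⟩
  have h4 : matComm X Y = 1 + e ^ 2 • ((C * D - D * C) * U) := by
    rw [matComm, mul_assoc, ← hU, h3, add_mul, h1, smul_mul_assoc]
  rw [h4]
  conv_lhs => rw [h2]
  rw [mul_sub, mul_one, mul_smul_comm, smul_sub, smul_smul, smul_neg, ← pow_succ]
  abel

theorem det_matComm {A B : Matrix (Fin n) (Fin n) R} (hA : IsUnit A.det) (hB : IsUnit B.det) :
    (matComm A B).det = 1 := by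
  have hAB : IsUnit (B.det * A.det) := hB.mul hA
  refine hAB.mul_left_injective ?_
  have : matComm A B * (B * A) = A * B := by
    rw [matComm, mul_assoc, ← mul_assoc (B⁻¹), Matrix.nonsing_inv_mul _ hB, one_mul, mul_assoc,
      Matrix.nonsing_inv_mul _ hA, mul_one]
  change _ * _ = 1 * _
  rw [← Matrix.det_mul B A, ← Matrix.det_mul, this, one_mul, Matrix.det_mul, Matrix.det_mul,
    mul_comm]

theorem matComm_one_one : matComm (1 : Matrix (Fin n) (Fin n) R) 1 = 1 := by
  simp [matComm]

theorem map_matComm {S : Type*} [CommRing S] (φ : S →+* R) {A B : Matrix (Fin n) (Fin n) S}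
    (hA : IsUnit A.det) (hB : IsUnit B.det) :
    φ.mapMatrix (matComm A B) = matComm (φ.mapMatrix A) (φ.mapMatrix B) := by
  have key : ∀ M : Matrix (Fin n) (Fin n) S, IsUnit M.det →
      φ.mapMatrix M⁻¹ = (φ.mapMatrix M)⁻¹ := fun M hM =>
    (Matrix.inv_eq_left_inv (by rw [← map_mul, Matrix.nonsing_inv_mul _ hM, map_one])).symm
  rw [matComm, matComm, map_mul, map_mul, map_mul, key A hA, key B hB]

end MatrixExpansion

section RelationExpansion

variable {R : Type*} [CommRing R] {n : ℕ}

theorem exists_one_add_smul_pow_eq {p s : ℕ} [Fact p.Prime] [CharP R p] (hq : 3 ≤ p ^ s) (e : R)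
    (C : Matrix (Fin n) (Fin n) R) : ∃ G, (1 + e • C) ^ p ^ s = 1 + e ^ 3 • G := by
  rcases isEmpty_or_nonempty (Fin n) with hn | hn
  · exact ⟨0, Subsingleton.elim _ _⟩
  refine ⟨e ^ (p ^ s - 3) • C ^ p ^ s, ?_⟩
  rw [add_pow_char_pow_of_commute p s (Commute.one_left _), one_pow, smul_pow, smul_smul, ← pow_add,
    Nat.add_sub_cancel' hq]

theorem pow_three_dvd_commutator_add_commutator {p s : ℕ} [Fact p.Prime] [CharP R p]
    (hq : 3 ≤ p ^ s) {M : Fin 4 → Matrix (Fin n) (Fin n) R} (hM : ∀ k, IsUnit (1 + M k).det)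
    (h : (1 + M 0) ^ p ^ s *
      (matComm (1 + M 0) (1 + M 1) * matComm (1 + M 2) (1 + M 3)) = 1)
    {e : R} (he : ∀ k i j, e ∣ M k i j) (i j : Fin n) :
    e ^ 3 ∣ ((M 0 * M 1 - M 1 * M 0) + (M 2 * M 3 - M 3 * M 2)) i j := by
  choose N hN using he
  have hMN : ∀ k, M k = e • Matrix.of (N k) := fun k => by
    ext i j
    simp [hN]
  generalize hE : (fun k => Matrix.of (N k)) = E at hMN
  replace hMN : ∀ k, M k = e • E k := fun k => by rw [hMN, ← hE]
  simp only [hMN] at h hM ⊢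
  obtain ⟨G₀, h₀⟩ := exists_one_add_smul_pow_eq hq e (E 0)
  obtain ⟨G₁, h₁⟩ := matComm_one_add_smul e _ _ (hM 0) (hM 1)
  obtain ⟨G₂, h₂⟩ := matComm_one_add_smul e _ _ (hM 2) (hM 3)
  rw [h₀, h₁, h₂] at h
  set K₁ := E 0 * E 1 - E 1 * E 0
  set K₂ := E 2 * E 3 - E 3 * E 2
  have hK : (e • E 0) * (e • E 1) - (e • E 1) * (e • E 0) +
      ((e • E 2) * (e • E 3) - (e • E 3) * (e • E 2)) = e ^ 2 • (K₁ + K₂) := by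
    simp only [K₁, K₂, smul_mul_assoc, mul_smul_comm, smul_add, smul_sub, pow_two, mul_smul]
  rw [hK]
  have key : ∃ G, e ^ 2 • (K₁ + K₂) = e ^ 3 • G := by
    refine ⟨-(G₀ * ((1 + e ^ 2 • K₁ + e ^ 3 • G₁) * (1 + e ^ 2 • K₂ + e ^ 3 • G₂)) + G₁ + G₂ +
      (e • (K₁ * K₂) + e ^ 2 • (K₁ * G₂ + G₁ * K₂) + e ^ 3 • (G₁ * G₂))), ?_⟩
    rw [add_mul, one_mul, smul_mul_assoc] at h
    rw [smul_neg, eq_neg_iff_add_eq_zero, ← sub_eq_zero.2 h]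
    generalize G₀ * _ = P
    simp only [add_mul, mul_add, one_mul, mul_one, smul_mul_assoc, mul_smul_comm, smul_add,
      smul_smul, ← pow_add, ← pow_succ]
    norm_num
    abel
  obtain ⟨G, hG⟩ := key
  rw [hG]
  exact ⟨G i j, rfl⟩

theorem det_one_add_pow_eq_one {q : ℕ} {C D A B : Matrix (Fin n) (Fin n) R}
    (hC : IsUnit C.det) (hD : IsUnit D.det) (hA : IsUnit A.det) (hB : IsUnit B.det)
    (h : C ^ q * (matComm C D * matComm A B) = 1) : C.det ^ q = 1 := by
  simpa [det_matComm hC hD, det_matComm hA hB] using congrArg Matrix.det h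

variable {S : Type*} [CommRing S]

theorem isUnit_det_Xt (N : ℕ) (k : Fin N) : IsUnit (Xt (A := S) N n k).det := by
  rw [MvPowerSeries.isUnit_iff_constantCoeff, RingHom.map_det]
  have : (MvPowerSeries.constantCoeff (R := S)).mapMatrix (Xt N n k) = 1 := by
    ext i j
    by_cases hij : i = j <;> simp [Xt, varMatrix, Matrix.one_apply, hij]
  rw [this, Matrix.det_one]
  exact isUnit_one

theorem mapMatrix_relMatrix {q m : ℕ}
    (φ : MvPowerSeries (Fin (2 * m + 2) × Fin n × Fin n) S →+* R) :
    φ.mapMatrix (relMatrix q m n) = (φ.mapMatrix (Xt _ n ⟨0, by omega⟩)) ^ q *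
      (List.ofFn (fun i : Fin (m + 1) =>
      matComm (φ.mapMatrix (Xt (2 * m + 2) n ⟨2 * i, by have := i.isLt; omega⟩))
        (φ.mapMatrix (Xt (2 * m + 2) n ⟨2 * i + 1, by have := i.isLt; omega⟩)))).prod := by
  rw [relMatrix, map_mul, map_pow, map_list_prod, List.map_ofFn]
  congr 3
  ext1 i
  exact map_matComm φ (isUnit_det_Xt _ _) (isUnit_det_Xt _ _)

theorem mapMatrix_relMatrix_of_forall_eq_one {q m : ℕ} (hm : 1 ≤ m)
    (φ : MvPowerSeries (Fin (2 * m + 2) × Fin n × Fin n) S →+* R)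
    (hφ : ∀ k : Fin (2 * m + 2), 4 ≤ (k : ℕ) → φ.mapMatrix (Xt _ n k) = 1) :
    φ.mapMatrix (relMatrix q m n) = (φ.mapMatrix (Xt _ n ⟨0, by omega⟩)) ^ q *
      (matComm (φ.mapMatrix (Xt _ n ⟨0, by omega⟩)) (φ.mapMatrix (Xt _ n ⟨1, by omega⟩)) *
        matComm (φ.mapMatrix (Xt _ n ⟨2, by omega⟩)) (φ.mapMatrix (Xt _ n ⟨3, by omega⟩))) := by
  obtain ⟨m, rfl⟩ := Nat.exists_eq_add_of_le' hm
  rw [mapMatrix_relMatrix, List.ofFn_succ, List.ofFn_succ, List.prod_cons, List.prod_cons]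
  have h1 : (List.ofFn fun i : Fin m => matComm
      (φ.mapMatrix (Xt (2 * (m + 1) + 2) n ⟨2 * i.succ.succ, by simp; omega⟩))
      (φ.mapMatrix (Xt (2 * (m + 1) + 2) n
        ⟨2 * i.succ.succ + 1, by simp⟩))).prod = 1 := by
    refine List.prod_eq_one fun x hx => ?_
    obtain ⟨i, rfl⟩ := (List.mem_ofFn' _ _).1 hx
    dsimp only
    rw [hφ _ (by simp; omega), hφ _ (by simp; omega), matComm_one_one]
  rw [h1, mul_one]
  rfl

end RelationExpansion

section Weights

/-- The involution of `Fin 4` matching the two matrices of each commutator. -/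
def conjIdx : Fin 4 → Fin 4 := ![1, 0, 3, 2]

/-- Centred integer weights of the entries of the four matrices. -/
def intWeight (n : ℕ) (c : Fin 4) (a b : ℤ) : ℤ :=
  ![b ^ 2 - 2 * b * (a - 1) - 4 * n ^ 2 * (2 * a - 1), 2 * b * a + 8 * n ^ 2 * b,
    b ^ 2 + 2 * a * b, -2 * b * a] c

/-- Positive natural weights, large multiples of `n ^ 3` shifted by `intWeight`. -/
def natWeight (n : ℕ) (x : Fin 4 × Fin n × Fin n) : ℕ :=
  (200 * (n : ℤ) ^ 3 + intWeight n x.1 (x.2.1 : ℕ) (x.2.2 : ℕ)).toNat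

/-- The position of the dominant summand in the `(i, j)` entry of the sum of commutators. -/
def mainIdx {n : ℕ} (i j : Fin n) : Fin 4 × Fin n :=
  if (i : ℕ) ≤ j then (2, ⟨j - i, by omega⟩) else (0, ⟨i - j - 1, by omega⟩)

variable {n : ℕ}

theorem abs_intWeight_le (c : Fin 4) (a b : Fin n) :
    |intWeight n c (a : ℕ) (b : ℕ)| ≤ 11 * (n : ℤ) ^ 3 := by
  obtain ⟨a, ha⟩ := a
  obtain ⟨b, hb⟩ := b
  have hn : (1 : ℤ) ≤ n := by omega
  have ha' : (a : ℤ) + 1 ≤ n := by omega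
  have hb' : (b : ℤ) + 1 ≤ n := by omega
  have ha0 : (0 : ℤ) ≤ a := by omega
  have hb0 : (0 : ℤ) ≤ b := by omega
  have hab : (a : ℤ) * b ≤ n ^ 2 := by nlinarith
  have hab0 : (0 : ℤ) ≤ a * b := by positivity
  have hbb : (b : ℤ) ^ 2 ≤ n ^ 2 := by nlinarith
  have hbn : (b : ℤ) ≤ n ^ 2 := by nlinarith
  have hn3 : (n : ℤ) ^ 2 ≤ n ^ 3 := by nlinarith [sq_nonneg (n : ℤ)]
  have hna : (n : ℤ) ^ 2 * a ≤ n ^ 3 := by nlinarith [sq_nonneg (n : ℤ)]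
  have hnb : (n : ℤ) ^ 2 * b ≤ n ^ 3 := by nlinarith [sq_nonneg (n : ℤ)]
  have hna0 : (0 : ℤ) ≤ n ^ 2 * a := by positivity
  have hnb0 : (0 : ℤ) ≤ n ^ 2 * b := by positivity
  have hb20 : (0 : ℤ) ≤ (b : ℤ) ^ 2 := by positivity
  rw [abs_le]
  fin_cases c <;> simp [intWeight] <;> constructor <;> nlinarith

theorem coe_natWeight (x : Fin 4 × Fin n × Fin n) :
    (natWeight n x : ℤ) = 200 * (n : ℤ) ^ 3 + intWeight n x.1 (x.2.1 : ℕ) (x.2.2 : ℕ) := by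
  have := abs_le.1 (abs_intWeight_le x.1 x.2.1 x.2.2)
  have h3 : (0 : ℤ) ≤ (n : ℤ) ^ 3 := by positivity
  rw [natWeight, Int.toNat_of_nonneg (by linarith)]

theorem natWeight_pos (x : Fin 4 × Fin n × Fin n) : 0 < natWeight n x := by
  have := abs_le.1 (abs_intWeight_le x.1 x.2.1 x.2.2)
  have hn : 0 < n := x.2.1.pos
  have h3 : (0 : ℤ) < (n : ℤ) ^ 3 := by positivity
  have := coe_natWeight x
  omega

theorem natWeight_add_lt (x y z : Fin 4 × Fin n × Fin n) :
    natWeight n x + natWeight n y < 3 * natWeight n z := by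
  have hx := abs_le.1 (abs_intWeight_le x.1 x.2.1 x.2.2)
  have hy := abs_le.1 (abs_intWeight_le y.1 y.2.1 y.2.2)
  have hz := abs_le.1 (abs_intWeight_le z.1 z.2.1 z.2.2)
  have hn : 0 < n := x.2.1.pos
  have h3 : (0 : ℤ) < (n : ℤ) ^ 3 := by positivity
  have := coe_natWeight x
  have := coe_natWeight y
  have := coe_natWeight z
  omega

theorem natWeight_mainIdx_lt {i j : Fin n} (hij : (i : ℕ) ≠ 0 ∨ (j : ℕ) ≠ 0) {t : Fin 4 × Fin n}
    (ht : t ≠ mainIdx i j) :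
    natWeight n ((mainIdx i j).1, i, (mainIdx i j).2) +
        natWeight n (conjIdx (mainIdx i j).1, (mainIdx i j).2, j) <
      natWeight n (t.1, i, t.2) + natWeight n (conjIdx t.1, t.2, j) := by
  zify
  simp only [coe_natWeight]
  obtain ⟨i, hi⟩ := i
  obtain ⟨j, hj⟩ := j
  obtain ⟨c, k, hk⟩ := t
  have hi' : (i : ℤ) + 1 ≤ n := by omega
  have hj' : (j : ℤ) + 1 ≤ n := by omega
  have hk' : (k : ℤ) + 1 ≤ n := by omega
  have hi0 : (0 : ℤ) ≤ i := by omega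
  have hj0 : (0 : ℤ) ≤ j := by omega
  have hk0 : (0 : ℤ) ≤ k := by omega
  have hki : (k : ℤ) * i ≤ n ^ 2 := by nlinarith
  have hkj : (k : ℤ) * j ≤ n ^ 2 := by nlinarith
  have hki0 : (0 : ℤ) ≤ k * i := by positivity
  have hkj0 : (0 : ℤ) ≤ k * j := by positivity
  have hn2 : (0 : ℤ) < (n : ℤ) ^ 2 := by
    have : 0 < n := by omega
    positivity
  rcases le_or_gt i j with h | h
  · have hm : mainIdx (⟨i, hi⟩ : Fin n) ⟨j, hj⟩ = (2, ⟨j - i, by omega⟩) := by simp [mainIdx, h]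
    rw [hm] at ht ⊢
    have h' : (0 : ℤ) ≤ (j : ℤ) - i := by omega
    have hjpos : (0 : ℤ) < j := by
      simp only at hij
      omega
    fin_cases c <;> simp [intWeight, conjIdx, Nat.cast_sub h] at ht ⊢
    · nlinarith [mul_nonneg h' hk0, mul_nonneg hn2.le h']
    · nlinarith [mul_nonneg h' hk0, mul_nonneg hn2.le h']
    · have : 0 < ((k : ℤ) + i - j) ^ 2 := by
        have : (k : ℤ) + i - j ≠ 0 := by omega
        positivity
      nlinarith
    · nlinarith [mul_nonneg h' hk0]
  · have hm : mainIdx (⟨i, hi⟩ : Fin n) ⟨j, hj⟩ = (0, ⟨i - j - 1, by omega⟩) := by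
      simp [mainIdx, h]
    have hcast : ((i - j - 1 : ℕ) : ℤ) = i - j - 1 := by omega
    rw [hm] at ht ⊢
    have h' : (0 : ℤ) ≤ (i : ℤ) - j - 1 := by omega
    fin_cases c <;> simp [intWeight, conjIdx, hcast] at ht ⊢
    · have : 0 < ((k : ℤ) - i + j + 1) ^ 2 := by
        have : (k : ℤ) - i + j + 1 ≠ 0 := by omega
        positivity
      nlinarith
    · nlinarith [mul_nonneg h' hk0, mul_nonneg hn2.le h']
    · nlinarith [mul_nonneg h' hk0, mul_nonneg hn2.le h']
    · nlinarith [mul_nonneg h' hk0, mul_nonneg hn2.le h']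

end Weights

section Domination

variable {V Γ₀ : Type*} [CommRing V] [LinearOrderedCommGroupWithZero Γ₀] {n : ℕ}

theorem commutator_add_commutator_apply (M : Fin 4 → Matrix (Fin n) (Fin n) V) (i j : Fin n) :
    ((M 0 * M 1 - M 1 * M 0) + (M 2 * M 3 - M 3 * M 2)) i j =
      ∑ t : Fin 4 × Fin n, ![1, -1, 1, -1] t.1 * (M t.1 i t.2 * M (conjIdx t.1) t.2 j) := by
  rw [Fintype.sum_prod_type, Fin.sum_univ_four]
  simp [Matrix.mul_apply, conjIdx]
  ring

theorem Valuation.le_sum_or_exists_le (v : Valuation V Γ₀) {ι : Type*} [Fintype ι] [DecidableEq ι]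
    (g : ι → V) (i : ι) : v (g i) ≤ v (∑ j, g j) ∨ ∃ j ≠ i, v (g i) ≤ v (g j) := by
  by_contra! h
  by_cases h0 : v (g i) = 0
  · exact absurd h.1 (by rw [h0]; exact not_lt_zero)
  refine lt_irrefl (v (g i)) ?_
  have hlt : v (∑ j ∈ Finset.univ.erase i, g j) < v (g i) :=
    v.map_sum_lt h0 fun j hj => h.2 j (Finset.ne_of_mem_erase hj)
  calc v (g i) = v (∑ j, g j - ∑ j ∈ Finset.univ.erase i, g j) := by
        rw [← Finset.add_sum_erase _ _ (Finset.mem_univ i), add_sub_cancel_right]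
    _ < v (g i) := v.map_sub_lt h.1 hlt

/-- Partner variables for the entry `(i, j)` of the sum of commutators. -/
def mainPair (i j : Fin n) : (Fin 4 × Fin n × Fin n) × (Fin 4 × Fin n × Fin n) :=
  (((mainIdx i j).1, i, (mainIdx i j).2), (conjIdx (mainIdx i j).1, (mainIdx i j).2, j))

theorem valuation_eq_zero_of_commutator_le (v : Valuation V Γ₀)
    {M : Fin 4 → Matrix (Fin n) (Fin n) V} {f : Fin 4 × Fin n × Fin n → V}
    (hfM : ∀ k a b, f (k, a, b) = M k a b) (hlt : ∀ x, v (f x) < 1)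
    (hmax : ∀ x, (∀ y, v (f y) ≤ v (f x)) → ∀ i j,
      v (((M 0 * M 1 - M 1 * M 0) + (M 2 * M 3 - M 3 * M 2)) i j) ≤ v (f x) ^ 3)
    (hpair : ∀ i j : Fin n, v (f (mainPair i j).1) ^ natWeight n (mainPair i j).2 =
      v (f (mainPair i j).2) ^ natWeight n (mainPair i j).1)
    (h0 : ∀ a b : Fin n, a ≤ b → v (M 0 a b) = 0)
    (h1 : ∀ a b : Fin n, n ≤ a + b + 1 → v (M 1 a b) = 0)
    (h2 : ∀ a b : Fin n, n ≤ a + b → v (M 2 a b) = 0)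
    (h3 : ∀ a b : Fin n, b < a → v (M 3 a b) = 0)
    (h2' : ∀ a b : Fin n, (a : ℕ) = 0 → (b : ℕ) = 0 → v (M 2 a b) = 0)
    (x : Fin 4 × Fin n × Fin n) : v (f x) = 0 := by
  have hdom : ∀ i j : Fin n, (i : ℕ) ≠ 0 ∨ (j : ℕ) ≠ 0 → ∃ l : List (Fin 4 × Fin n × Fin n),
      natWeight n (mainPair i j).1 + natWeight n (mainPair i j).2 < (l.map (natWeight n)).sum ∧
      v (f (mainPair i j).1) * v (f (mainPair i j).2) ≤ (l.map (v ∘ f)).prod := fun i j hij => by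
    have : Nonempty (Fin 4 × Fin n × Fin n) := ⟨x⟩
    obtain ⟨z, hz⟩ := Finite.exists_max fun x => v (f x)
    have hterm : ∀ t : Fin 4 × Fin n, v ((![1, -1, 1, -1] : Fin 4 → V) t.1 *
        (M t.1 i t.2 * M (conjIdx t.1) t.2 j)) =
        v (f (t.1, i, t.2)) * v (f (conjIdx t.1, t.2, j)) := fun t => by
      have hs : v ((![1, -1, 1, -1] : Fin 4 → V) t.1) = 1 := by
        obtain ⟨c, k⟩ := t
        fin_cases c <;> simp
      rw [map_mul, hs, one_mul, map_mul, hfM, hfM]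
    rcases v.le_sum_or_exists_le (fun t : Fin 4 × Fin n => ![1, -1, 1, -1] t.1 *
        (M t.1 i t.2 * M (conjIdx t.1) t.2 j)) (mainIdx i j) with h | ⟨t, ht, h⟩
    · refine ⟨[z, z, z], ?_, ?_⟩
      · have := natWeight_add_lt (mainPair i j).1 (mainPair i j).2 z
        simp only [List.map_cons, List.map_nil, List.sum_cons, List.sum_nil]
        omega
      · rw [← commutator_add_commutator_apply, hterm] at h
        refine (h.trans (hmax z hz i j)).trans_eq ?_
        simp [pow_three]
    · refine ⟨[(t.1, i, t.2), (conjIdx t.1, t.2, j)], ?_, ?_⟩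
      · simpa [mainPair] using natWeight_mainIdx_lt hij ht
      · rw [hterm, hterm] at h
        simpa [mainPair] using h
  have h00 : ∀ i j : Fin n, (i : ℕ) = 0 → (j : ℕ) = 0 → v (f (mainPair i j).1) = 0 ∧
      v (f (mainPair i j).2) = 0 := fun i j hi hj => by
    have hA : v (f (mainPair i j).1) = 0 := by
      simp only [mainPair, mainIdx, hi, hj, le_refl, if_true, hfM]
      exact h2' _ _ hi rfl
    have := hpair i j
    rw [hA, zero_pow (natWeight_pos _).ne'] at this
    exact ⟨hA, eq_zero_of_pow_eq_zero this.symm⟩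
  have hfst : ∀ i j x, x = (mainPair i j).1 → v (f x) = 0 ∨ ∃ y, v (f x) ^ natWeight n y =
      v (f y) ^ natWeight n x ∧ ∃ l : List (Fin 4 × Fin n × Fin n),
      natWeight n x + natWeight n y < (l.map (natWeight n)).sum ∧
      v (f x) * v (f y) ≤ (l.map (v ∘ f)).prod := by
    rintro i j _ rfl
    by_cases hij : (i : ℕ) = 0 ∧ (j : ℕ) = 0
    · exact .inl (h00 i j hij.1 hij.2).1
    · exact .inr ⟨_, hpair i j, hdom i j (by omega)⟩
  have hsnd : ∀ i j x, x = (mainPair i j).2 → v (f x) = 0 ∨ ∃ y, v (f x) ^ natWeight n y =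
      v (f y) ^ natWeight n x ∧ ∃ l : List (Fin 4 × Fin n × Fin n),
      natWeight n x + natWeight n y < (l.map (natWeight n)).sum ∧
      v (f x) * v (f y) ≤ (l.map (v ∘ f)).prod := by
    rintro i j _ rfl
    by_cases hij : (i : ℕ) = 0 ∧ (j : ℕ) = 0
    · exact .inl (h00 i j hij.1 hij.2).2
    · refine .inr ⟨_, (hpair i j).symm, ?_⟩
      rw [add_comm, mul_comm]
      exact hdom i j (by omega)
  refine eq_zero_of_forall_exists_partner (f := v ∘ f) natWeight_pos hlt ?_ x
  rintro ⟨c, a, b⟩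
  fin_cases c
  · rcases le_or_gt a b with h | h
    · exact .inl ((congrArg v (hfM _ _ _)).trans (h0 a b h))
    · have hab : (b : ℕ) < a := h
      refine hfst a ⟨a - b - 1, by omega⟩ _ ?_
      have h1 : ¬ (a : ℕ) ≤ a - b - 1 := by omega
      have h2 : (a : ℕ) - (a - b - 1) - 1 = b := by omega
      simp [mainPair, mainIdx, h1, h2]
  · rcases le_or_gt n (a + b + 1) with h | h
    · exact .inl ((congrArg v (hfM _ _ _)).trans (h1 a b h))
    · refine hsnd ⟨a + b + 1, h⟩ b _ ?_
      have h1 : ¬ (a + b + 1 : ℕ) ≤ b := by omega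
      have h2 : (a + b + 1 : ℕ) - b - 1 = a := by omega
      simp [mainPair, mainIdx, h1, h2, conjIdx]
  · rcases le_or_gt n (a + b) with h | h
    · exact .inl ((congrArg v (hfM _ _ _)).trans (h2 a b h))
    · refine hfst a ⟨a + b, h⟩ _ ?_
      simp [mainPair, mainIdx]
  · rcases lt_or_ge b a with h | h
    · exact .inl ((congrArg v (hfM _ _ _)).trans (h3 a b h))
    · have hab : (a : ℕ) ≤ b := h
      refine hsnd ⟨b - a, by omega⟩ b _ ?_
      have h1 : (b : ℕ) - (b - a) = a := by omega
      simp [mainPair, mainIdx, h1, conjIdx]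

end Domination

section Parameters

open MvPowerSeries

variable {A : Type*} [CommRing A] {m n : ℕ}

/-- The variables of the first four matrices. -/
def quadVar (hm : 1 ≤ m) (x : Fin 4 × Fin n × Fin n) :
    MvPowerSeries (Fin (2 * m + 2) × Fin n × Fin n) A :=
  X (Fin.castLE (by omega) x.1, x.2)

/-- Parameters that, together with a uniformizer and the relations, form a system of parameters of
the power series ring. -/
def extraParam (hm : 1 ≤ m) (t : Fin (2 * m + 1) × Fin n × Fin n) :
    MvPowerSeries (Fin (2 * m + 2) × Fin n × Fin n) A :=
  if (t.1 : ℕ) = 0 then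
    quadVar hm (mainPair t.2.1 t.2.2).1 ^ natWeight n (mainPair t.2.1 t.2.2).2 -
      quadVar hm (mainPair t.2.1 t.2.2).2 ^ natWeight n (mainPair t.2.1 t.2.2).1
  else if (t.1 : ℕ) = 1 then
    if t.2.2 < t.2.1 then quadVar hm (3, t.2)
    else if (t.2.1 : ℕ) = 0 ∧ (t.2.2 : ℕ) = 0 then quadVar hm (2, t.2) else quadVar hm (0, t.2)
  else if (t.1 : ℕ) = 2 then
    if n ≤ (t.2.1 : ℕ) + t.2.2 then quadVar hm (2, t.2)
    else quadVar hm (1, Fin.rev t.2.1, Fin.rev t.2.2)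
  else X (t.1.succ, t.2)

theorem det_one_add_of_forall_le_eq_zero {R : Type*} [CommRing R] {C : Matrix (Fin n) (Fin n) R}
    {o : Fin n} (h : ∀ a b : Fin n, a ≤ b → (a ≠ o ∨ b ≠ o) → C a b = 0) :
    (1 + C).det = 1 + C o o := by
  rw [Matrix.det_of_isLowerTriangular (1 + C) fun a b (hab : a < b) => by
    rw [Matrix.add_apply, Matrix.one_apply_ne hab.ne, h a b hab.le, add_zero]
    by_contra! hne
    exact hab.ne (hne.1.trans hne.2.symm)]
  rw [Finset.prod_eq_single o (fun a _ ha => by simp [h a a le_rfl (.inl ha)]) (by simp)]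
  simp

universe u

theorem exists_valuationSubring_of_isPrime {S : Type u} [CommRing S] [IsLocalRing S]
    {Q : Ideal S} (hQ : Q.IsPrime) : ∃ (K : Type u) (_ : Field K) (V : ValuationSubring K)
      (ψ : S →+* V), RingHom.ker ψ = Q ∧ IsLocalHom ψ := by
  let K := FractionRing (S ⧸ Q)
  obtain ⟨V, h, hloc⟩ := IsLocalRing.exists_factor_valuationRing (R := S)
    ((algebraMap (S ⧸ Q) K).comp (Ideal.Quotient.mk Q))
  refine ⟨K, inferInstance, V, _, ?_, hloc⟩
  ext g
  rw [RingHom.mem_ker, ← Ideal.Quotient.eq_zero_iff_mem,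
    ← (IsFractionRing.injective (S ⧸ Q) K).eq_iff, map_zero, Subtype.ext_iff]
  rfl

theorem X_mem_of_isPrime [IsLocalRing A] {p s : ℕ} [Fact p.Prime] (hq : 3 ≤ p ^ s) (hm : 1 ≤ m)
    {Q : Ideal (MvPowerSeries (Fin (2 * m + 2) × Fin n × Fin n) A)} (hQ : Q.IsPrime)
    (hp : (p : MvPowerSeries (Fin (2 * m + 2) × Fin n × Fin n) A) ∈ Q)
    (hrel : relIdeal (p ^ s) m n ≤ Q) (hy : ∀ t, extraParam hm t ∈ Q)
    (t : Fin (2 * m + 2) × Fin n × Fin n) : X t ∈ Q := by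
  obtain ⟨K, _, V, ψ, hker, hloc⟩ := exists_valuationSubring_of_isPrime hQ
  have hψ : ∀ g, g ∈ Q ↔ ψ g = 0 := fun g => by rw [← hker, RingHom.mem_ker]
  have : CharP V p := (CharP.charP_iff_prime_eq_zero Fact.out).2 (by
    rw [← map_natCast ψ]
    exact (hψ _).1 hp)
  let v : Valuation V V.ValueGroup := V.valuation.comap V.subtype
  have hv0 : ∀ a, v a = 0 ↔ a = 0 := fun a => by
    change V.valuation (a : K) = 0 ↔ _
    rw [_root_.map_eq_zero]
    exact ZeroMemClass.coe_eq_zero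
  have hdvd : ∀ a b, v a ≤ v b ↔ b ∣ a := fun a b => by
    refine (V.valuation_le_iff _ _).trans ⟨fun ⟨c, hc⟩ => ⟨c, ?_⟩, fun ⟨c, hc⟩ => ⟨c, ?_⟩⟩
    · rw [mul_comm]
      exact Subtype.ext hc.symm
    · rw [hc, mul_comm]
      rfl
  let f : Fin 4 × Fin n × Fin n → V := fun x => ψ (quadVar hm x)
  let M : Fin 4 → Matrix (Fin n) (Fin n) V := fun k => Matrix.of fun i j => f (k, i, j)
  have hfM : ∀ k a b, f (k, a, b) = M k a b := fun k a b => rfl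
  have hXt : ∀ k : Fin 4, ψ.mapMatrix (Xt (2 * m + 2) n (Fin.castLE (by omega) k)) = 1 + M k :=
    fun k => by
      rw [Xt, map_add, map_one]
      rfl
  have hMdet : ∀ k, IsUnit (1 + M k).det := fun k => by
    rw [← hXt, ← RingHom.map_det]
    exact (isUnit_det_Xt _ _).map ψ
  have hX4 : ∀ (k : Fin (2 * m + 2)) (a b : Fin n), 4 ≤ (k : ℕ) → X (k, a, b) ∈ Q :=
    fun k a b hk => by
      have h := hy (⟨k - 1, by omega⟩, a, b)
      have e0 : ¬ ((k : ℕ) - 1 = 0) := by omega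
      have e1 : ¬ ((k : ℕ) - 1 = 1) := by omega
      have e2 : ¬ ((k : ℕ) - 1 = 2) := by omega
      have e3 : (⟨k - 1, by omega⟩ : Fin (2 * m + 1)).succ = k := Fin.ext (by simp; omega)
      simpa only [extraParam, e0, e1, e2, e3, if_false] using h
  have hone : (1 + M 0) ^ p ^ s *
      (matComm (1 + M 0) (1 + M 1) * matComm (1 + M 2) (1 + M 3)) = 1 := by
    simp only [← hXt]
    refine (mapMatrix_relMatrix_of_forall_eq_one hm ψ fun k hk => ?_).symm.trans ?_
    · rw [Xt, map_add, map_one, add_eq_left]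
      ext a b
      exact congrArg Subtype.val ((hψ _).1 (hX4 k a b hk))
    · rw [← sub_eq_zero, ← map_one ψ.mapMatrix, ← map_sub]
      ext a b
      exact congrArg Subtype.val
        ((hψ _).1 (hrel (Ideal.subset_span (Set.mem_range_self (a, b)))))
  have hlt : ∀ x, v (f x) < 1 := fun x => by
    refine (V.valuation_lt_one_iff _).1 fun hu => ?_
    have := (isUnit_of_map_unit ψ _ hu).map (constantCoeff (R := A))
    simp [quadVar] at this
  have hpair : ∀ i j : Fin n, v (f (mainPair i j).1) ^ natWeight n (mainPair i j).2 =
      v (f (mainPair i j).2) ^ natWeight n (mainPair i j).1 := fun i j => by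
    have h := (hψ _).1 (hy (⟨0, by omega⟩, i, j))
    simp only [extraParam, if_true, map_sub, map_pow, sub_eq_zero] at h
    simpa only [f, ← map_pow] using congrArg v h
  have hone_row : ∀ a b : Fin n, (if b < a then f (3, a, b) else
      if (a : ℕ) = 0 ∧ (b : ℕ) = 0 then f (2, a, b) else f (0, a, b)) = 0 := fun a b => by
    have h := (hψ _).1 (hy (⟨1, by omega⟩, a, b))
    simpa only [extraParam, one_ne_zero, if_false, if_true, apply_ite ψ] using h
  have htwo_row : ∀ a b : Fin n, (if n ≤ (a : ℕ) + b then f (2, a, b) else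
      f (1, Fin.rev a, Fin.rev b)) = 0 := fun a b => by
    have h := (hψ _).1 (hy (⟨2, by omega⟩, a, b))
    simpa only [extraParam, two_ne_zero, OfNat.ofNat_ne_one, if_false, if_true, apply_ite ψ] using h
  have hC : ∀ a b : Fin n, a ≤ b → ¬ ((a : ℕ) = 0 ∧ (b : ℕ) = 0) → M 0 a b = 0 :=
    fun a b hab h0 => by
      have h := hone_row a b
      rwa [if_neg hab.not_gt, if_neg h0] at h
  have hC0 : ∀ a b : Fin n, (a : ℕ) = 0 ∧ (b : ℕ) = 0 → M 0 a b = 0 := fun a b h0 => by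
    obtain rfl : a = b := Fin.ext (h0.1.trans h0.2.symm)
    have h := det_one_add_pow_eq_one (hMdet 0) (hMdet 1) (hMdet 2) (hMdet 3) hone
    rw [det_one_add_of_forall_le_eq_zero (o := a) fun b c hbc hne => hC b c hbc fun hz => ?_,
      add_pow_char_pow, one_pow, add_eq_left] at h
    · exact eq_zero_of_pow_eq_zero h
    · rcases hne with hne | hne
      · exact hne (Fin.ext (hz.1.trans h0.1.symm))
      · exact hne (Fin.ext (hz.2.trans h0.1.symm))
  have hzero := valuation_eq_zero_of_commutator_le v hfM hlt (fun x hx i j => ?_) hpair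
    (fun a b hab => (hv0 _).2 <| by
      by_cases h0 : (a : ℕ) = 0 ∧ (b : ℕ) = 0
      exacts [hC0 a b h0, hC a b hab h0])
    (fun a b hab => (hv0 _).2 <| by
      have h := htwo_row (Fin.rev a) (Fin.rev b)
      rwa [if_neg (by simp only [Fin.val_rev]; omega), Fin.rev_rev, Fin.rev_rev] at h)
    (fun a b hab => (hv0 _).2 <| by
      have h := htwo_row a b
      rwa [if_pos hab] at h)
    (fun a b hab => (hv0 _).2 <| by
      have h := hone_row a b
      rwa [if_pos hab] at h)
    (fun a b ha hb => (hv0 _).2 <| by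
      have h := hone_row a b
      rwa [if_neg (fun hlt => by have : (b : ℕ) < a := hlt; omega), if_pos ⟨ha, hb⟩] at h)
  · obtain ⟨k, a, b⟩ := t
    rcases le_or_gt 4 (k : ℕ) with hk | hk
    · exact hX4 k a b hk
    · exact (hψ _).2 ((hv0 _).1 (hzero (⟨k, hk⟩, a, b)))
  · rw [← map_pow, hdvd]
    exact pow_three_dvd_commutator_add_commutator hq hMdet hone
      (fun k a b => (hdvd _ _).1 (hx (k, a, b))) i j

end Parameters

section Assembly

open IsLocalRing MvPowerSeries

variable {A : Type*} [CommRing A] {m n : ℕ}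

theorem constantCoeff_relMatrix_sub_one (q : ℕ) (hm : 1 ≤ m) (i j : Fin n) :
    constantCoeff ((relMatrix (A := A) q m n - 1) i j) = 0 := by
  have hXt : ∀ k, (constantCoeff (R := A)).mapMatrix (Xt (2 * m + 2) n k) = 1 := fun k => by
    rw [Xt, map_add, map_one, add_eq_left]
    ext a b
    exact constantCoeff_X _
  have h := mapMatrix_relMatrix_of_forall_eq_one (q := q) hm (constantCoeff (R := A))
    fun k _ => hXt k
  simp only [hXt, one_pow, matComm_one_one, mul_one] at h
  rw [← map_one (constantCoeff (R := A)).mapMatrix, ← sub_eq_zero, ← map_sub] at h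
  exact congrFun (congrFun h i) j

theorem constantCoeff_extraParam (hm : 1 ≤ m) (t : Fin (2 * m + 1) × Fin n × Fin n) :
    constantCoeff (extraParam (A := A) hm t) = 0 := by
  have hquad : ∀ x, constantCoeff (quadVar (A := A) (n := n) hm x) = 0 := fun x =>
    constantCoeff_X _
  rw [extraParam]
  split_ifs <;>
    simp only [map_sub, map_pow, hquad, zero_pow (natWeight_pos _).ne', sub_zero, constantCoeff_X]

theorem ringKrullDim_defRing_and_regularMod [IsLocalRing A] [IsNoetherianRing A] {p s : ℕ}
    [Fact p.Prime] (hq : 3 ≤ p ^ s) (hm : 1 ≤ m) {ϖ : A} (hϖ : maximalIdeal A = Ideal.span {ϖ})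
    (hϖ' : ϖ ∈ nonZeroDivisors A) (hp : (p : A) ∈ maximalIdeal A) :
    ringKrullDim (defRing (A := A) (p ^ s) m n) = (1 + n ^ 2 * (2 * m + 1) : ℕ) ∧
      RegularMod (relIdeal (A := A) (p ^ s) m n) (C ϖ) := by
  have hϖm : ϖ ∈ maximalIdeal A := hϖ ▸ Ideal.mem_span_singleton_self ϖ
  let f := (Finset.univ : Finset (Fin n × Fin n)).toList.map
    fun ij => (relMatrix (A := A) (p ^ s) m n - 1) ij.1 ij.2
  let y := (Finset.univ : Finset (Fin (2 * m + 1) × Fin n × Fin n)).toList.map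
    (extraParam (A := A) hm)
  have hfspan : Ideal.span {z | z ∈ f} = relIdeal (A := A) (p ^ s) m n := by
    rw [relIdeal]
    congr 1
    ext z
    simp [f]
  have hylen : y.length = n ^ 2 * (2 * m + 1) := by
    simp [y]
    ring
  have hlen : (f ++ C ϖ :: y).length = Nat.card (Fin (2 * m + 2) × Fin n × Fin n) + 1 := by
    simp [f, y]
    ring
  have hmem : ∀ z, (∀ x ∈ f ++ C ϖ :: y, x ∈ z) ↔
      relIdeal (A := A) (p ^ s) m n ≤ z ∧ C ϖ ∈ z ∧ ∀ t, extraParam hm t ∈ z := fun z => by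
    simp only [List.mem_append, List.mem_cons, or_imp, forall_and, forall_eq]
    refine and_congr ?_ (and_congr Iff.rfl ?_)
    · rw [← hfspan, Ideal.span_le]
      rfl
    · simp only [y, List.mem_map, Finset.mem_toList, Finset.mem_univ, true_and,
        forall_exists_index, forall_apply_eq_imp_iff]
  have key := ringKrullDim_quotient_eq_and_regularMod_of_forall_prime (f := f) (y := y)
    (x := C (σ := Fin (2 * m + 2) × Fin n × Fin n) ϖ)
    (hlen ▸ depthGE_bot_mvPowerSeries hϖm hϖ') ((hmem _).2 ⟨?_, ?_, fun t => ?_⟩)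
    fun Q hQ h => ?_
  · rw [hfspan, hylen, add_comm (n ^ 2 * _)] at key
    exact key
  · rw [relIdeal, Ideal.span_le]
    rintro _ ⟨ij, rfl⟩
    exact mem_maximalIdeal_iff_constantCoeff.2 <|
      (constantCoeff_relMatrix_sub_one (A := A) (p ^ s) hm ij.1 ij.2).symm ▸ zero_mem _
  · exact mem_maximalIdeal_iff_constantCoeff.2 (by rwa [constantCoeff_C])
  · exact mem_maximalIdeal_iff_constantCoeff.2 <|
      (constantCoeff_extraParam (A := A) hm t).symm ▸ zero_mem _
  · obtain ⟨hrel, hC, hy⟩ := (hmem Q).1 h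
    refine eq_maximalIdeal_of_forall_X_mem hϖ hQ hC fun t => X_mem_of_isPrime hq hm hQ ?_ hrel hy t
    obtain ⟨c, hc⟩ := Ideal.mem_span_singleton.1 (hϖ ▸ hp)
    rw [← map_natCast (C (σ := Fin (2 * m + 2) × Fin n × Fin n) (R := A)), hc, map_mul]
    exact Q.mul_mem_right _ hC

theorem regularMod_C_of_ne_zero [IsDomain A] [IsLocalRing A] [IsPrincipalIdealRing A]
    {σ : Type*} {I : Ideal (MvPowerSeries σ A)} {ϖ : A} (hϖ : maximalIdeal A = Ideal.span {ϖ})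
    (hϖ0 : ϖ ≠ 0) (h : RegularMod I (C ϖ)) {c : A} (hc : c ≠ 0) : RegularMod I (C c) := by
  have : IsDiscreteValuationRing A :=
    { not_a_field' := by rwa [hϖ, Ne, Ideal.span_singleton_eq_bot] }
  obtain ⟨k, u, rfl⟩ := IsDiscreteValuationRing.eq_unit_mul_pow_irreducible hc
    ((IsDiscreteValuationRing.irreducible_iff_uniformizer ϖ).2 hϖ)
  induction k with
  | zero =>
    intro r hr
    rw [pow_zero, mul_one] at hr
    exact (Ideal.unit_mul_mem_iff_mem I (u.isUnit.map C)).1 hr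
  | succ k ih =>
    intro r hr
    refine h r (ih (mul_ne_zero u.ne_zero (pow_ne_zero _ hϖ0)) _ ?_)
    rwa [pow_succ, ← mul_assoc, map_mul, mul_assoc] at hr

end Assembly

theorem framed_deformation_ring_dimension_and_flatness (p s q m n : ℕ) (hs : 1 ≤ s) (hq : q = p ^ s) (hq3 : 3 ≤ q)
    (hm : 1 ≤ m) (hn : 1 ≤ n) [Fact p.Prime]
    (L : Type) [Field L] [Algebra ℚ_[p] L] [FiniteDimensional ℚ_[p] L]
    [Algebra ℤ_[p] L] [IsScalarTower ℤ_[p] ℚ_[p] L] :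
    ringKrullDim (defRing (A := RingOfIntegers p L) q m n) = (1 + n ^ 2 * (2 * m + 1) : ℕ) ∧
    (p : defRing (A := RingOfIntegers p L) q m n) ∈
      nonZeroDivisors (defRing (A := RingOfIntegers p L) q m n) ∧
    Module.Flat (RingOfIntegers p L) (defRing (A := RingOfIntegers p L) q m n) := by
  subst hq
  have := isLocalRing_ringOfIntegers p L
  have := isDedekindDomain_ringOfIntegers p L
  have := isPrincipalIdealRing_ringOfIntegers p L
  have hp := natCast_prime_mem_maximalIdeal_ringOfIntegers p L
  have hp0 : (p : RingOfIntegers p L) ≠ 0 := fun h => by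
    have h' : (p : L) = 0 := by simpa using congrArg (Subtype.val) h
    rw [← map_natCast (algebraMap ℚ_[p] L), map_eq_zero, Nat.cast_eq_zero] at h'
    exact (Fact.out : p.Prime).ne_zero h'
  obtain ⟨ϖ, hϖ⟩ := (inferInstance :
    (IsLocalRing.maximalIdeal (RingOfIntegers p L)).IsPrincipal).principal
  have hϖ0 : ϖ ≠ 0 := by
    rintro rfl
    rw [hϖ] at hp
    exact hp0 (by simpa using hp)
  obtain ⟨hdim, hreg⟩ := ringKrullDim_defRing_and_regularMod (n := n) hq3 hm hϖ
    (mem_nonZeroDivisors_of_ne_zero hϖ0) hp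
  have hsmul : ∀ c : RingOfIntegers p L, c ≠ 0 →
      ∀ r : defRing (A := RingOfIntegers p L) (p ^ s) m n, c • r = 0 → r = 0 := fun c hc r hr => by
    obtain ⟨r, rfl⟩ := Ideal.Quotient.mk_surjective r
    rw [Ideal.Quotient.eq_zero_iff_mem]
    refine regularMod_C_of_ne_zero hϖ hϖ0 hreg hc r (Ideal.Quotient.eq_zero_iff_mem.1 ?_)
    rw [← hr, ← MvPowerSeries.smul_eq_C_mul]
    rfl
  refine ⟨hdim, mem_nonZeroDivisors_iff_right.2 fun r hr => hsmul p hp0 r ?_, ?_⟩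
  · rw [← hr, mul_comm r, Nat.cast_smul_eq_nsmul, nsmul_eq_mul]
  · rw [Module.Flat.flat_iff_torsion_eq_bot_of_isBezout, eq_bot_iff]
    rintro r ⟨⟨c, hc⟩, hr⟩
    exact hsmul c (nonZeroDivisors.ne_zero hc) r hr
end
end

section
/- In the power series ring S = 𝒪_L⟦X_1,…,X_{d+2}⟧, the list of 1 + n²(d+1) elements consisting of: the n² entries of the matrix X̃_2·X̃_1 − X̃_1^{q+1}·X̃_2, then the n²·d variables comprising the matrices X_3,…,X_{d+2}, and finally the element p, is a regular sequence on S (each element is a non-zero-divisor on the quotient of S by its predecessors, and the final quotient is nonzero). -/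
set_option synthInstance.maxHeartbeats 1000000
set_option maxHeartbeats 1000000

noncomputable section

/-- The entries of a square matrix, listed row by row. -/
def entriesList {R : Type*} [CommRing R] {n : ℕ} (M : Matrix (Fin n) (Fin n) R) : List R :=
  (List.finRange n).flatMap fun i => (List.finRange n).map fun j => M i j

section SystemOfParameters

open RingTheory.Sequence IsLocalRing CategoryTheory Abelian Pointwise

universe u

variable {R : Type u} [CommRing R] [IsNoetherianRing R] [IsLocalRing R]

theorem exists_mem_associatedPrimes_quotSMulTop {M : Type*} [AddCommGroup M] [Module R M]
    [Module.Finite R M] {x : R} (hx : IsSMulRegular M x) (hxm : x ∈ maximalIdeal R) {P : Ideal R}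
    (hP : P ∈ associatedPrimes R M) :
    ∃ Q ∈ associatedPrimes R (QuotSMulTop x M), P ≤ Q ∧ x ∈ Q := by
  rw [AssociatedPrimes.mem_iff, isAssociatedPrime_iff] at hP
  obtain ⟨hPp, v, hv⟩ := hP
  set U := Submodule.torsionBySet R M (P : Set R) with hU
  have hvU : v ∈ U := by
    rw [hU, Submodule.mem_torsionBySet_iff]
    rintro ⟨a, ha⟩
    rw [SetLike.mem_coe, hv, Submodule.mem_colon_singleton] at ha
    simpa using ha
  have hne : ¬ U ≤ x • (⊤ : Submodule R M) := by
    intro hle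
    have hbot : U = ⊥ := by
      refine Submodule.eq_bot_of_le_smul_of_le_jacobson_bot (Ideal.span {x}) U
        (IsNoetherian.noetherian U) ?_ ?_
      · intro u hu
        obtain ⟨w, -, rfl⟩ := hle hu
        refine Submodule.smul_mem_smul (Ideal.mem_span_singleton_self x) ?_
        rw [hU, Submodule.mem_torsionBySet_iff] at hu ⊢
        intro a
        refine hx ?_
        simpa [smul_comm x (a : R) w] using hu a
      · rw [IsLocalRing.jacobson_eq_maximalIdeal _ bot_ne_top, Ideal.span_singleton_le_iff_mem]
        exact hxm
    rw [hbot, Submodule.mem_bot] at hvU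
    exact hPp.ne_top (hv.trans (by simp [hvU]))
  obtain ⟨u, hu, hux⟩ := SetLike.not_le_iff_exists.1 hne
  have hu0 : (Submodule.Quotient.mk u : QuotSMulTop x M) ≠ 0 := fun h =>
    hux ((Submodule.Quotient.mk_eq_zero _).1 h)
  obtain ⟨Q, hQ, hle⟩ := exists_le_isAssociatedPrime_of_isNoetherianRing R _ hu0
  refine ⟨Q, hQ, fun a ha => hle ?_, hle ?_⟩
  · rw [Submodule.mem_colon_singleton, ← Submodule.Quotient.mk_smul]
    rw [hU, Submodule.mem_torsionBySet_iff] at hu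
    have := hu ⟨a, ha⟩
    simp only at this
    simp [this]
  · rw [Submodule.mem_colon_singleton, ← Submodule.Quotient.mk_smul, Submodule.mem_bot,
      Submodule.Quotient.mk_eq_zero]
    exact Submodule.smul_mem_pointwise_smul _ _ _ trivial

theorem length_le_ringKrullDim_quotient_of_mem_associatedPrimes {M : Type*} [AddCommGroup M]
    [Module R M] [Module.Finite R M] {rs : List R} (hrs : IsWeaklyRegular M rs)
    (hm : ∀ r ∈ rs, r ∈ maximalIdeal R) {P : Ideal R} (hP : P ∈ associatedPrimes R M) :
    (rs.length : WithBot ℕ∞) ≤ ringKrullDim (R ⧸ P) := by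
  induction rs generalizing M P with
  | nil =>
    have : Nontrivial (R ⧸ P) := Ideal.Quotient.nontrivial_iff.2 hP.isPrime.ne_top
    simpa using ringKrullDim_nonneg_of_nontrivial
  | cons x rs ih =>
    rw [isWeaklyRegular_cons_iff] at hrs
    obtain ⟨Q, hQ, hPQ, hxQ⟩ := exists_mem_associatedPrimes_quotSMulTop hrs.1 (hm x (by simp)) hP
    have hxP : x ∉ P := fun h => by
      have : x ∈ ⋃ p ∈ associatedPrimes R M, (p : Set R) := Set.mem_iUnion₂_of_mem hP h
      rw [biUnion_associatedPrimes_eq_compl_regular] at this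
      exact this hrs.1
    have := hP.isPrime
    have h1 := ringKrullDim_quotient_succ_le_of_nonZeroDivisor (r := Ideal.Quotient.mk P x)
      (mem_nonZeroDivisors_of_ne_zero (by rwa [Ne, Ideal.Quotient.eq_zero_iff_mem]))
    have h2 : ringKrullDim (R ⧸ Q) ≤
        ringKrullDim ((R ⧸ P) ⧸ Ideal.span {Ideal.Quotient.mk P x}) := by
      refine ringKrullDim_le_of_surjective (Ideal.Quotient.lift _ (Ideal.Quotient.factor hPQ) ?_)
        (Ideal.Quotient.lift_surjective_of_surjective _ _ (Ideal.Quotient.factor_surjective hPQ))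
      intro a ha
      have : Ideal.span {Ideal.Quotient.mk P x} ≤ RingHom.ker (Ideal.Quotient.factor hPQ) := by
        rw [Ideal.span_singleton_le_iff_mem, RingHom.mem_ker, Ideal.Quotient.factor_mk,
          Ideal.Quotient.eq_zero_iff_mem]
        exact hxQ
      exact this ha
    have h3 := ih hrs.2 (fun r hr => hm r (by simp [hr])) hQ
    calc ((x :: rs).length : WithBot ℕ∞) = (rs.length : WithBot ℕ∞) + 1 := by simp
      _ ≤ ringKrullDim ((R ⧸ P) ⧸ Ideal.span {Ideal.Quotient.mk P x}) + 1 := by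
        gcongr; exact h3.trans h2
      _ ≤ _ := h1

theorem ringKrullDim_quotient_le_length_s2 {P : Ideal R} [P.IsPrime] {ys : List R}
    (hm : ∀ y ∈ ys, y ∈ maximalIdeal R)
    (hQ : ∀ Q : Ideal R, Q.IsPrime → P ≤ Q → (∀ y ∈ ys, y ∈ Q) → Q = maximalIdeal R) :
    ringKrullDim (R ⧸ P) ≤ ys.length := by
  classical
  set s : Finset (R ⧸ P) := (ys.map (Ideal.Quotient.mk P)).toFinset with hs
  have hmem : ∀ y ∈ ys, Ideal.Quotient.mk P y ∈ (s : Set (R ⧸ P)) := fun y hy => by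
    simp only [hs, Finset.mem_coe, List.mem_toFinset, List.mem_map]
    exact ⟨y, hy, rfl⟩
  have hlocal : IsLocalRing (R ⧸ P) := .of_surjective' _ Ideal.Quotient.mk_surjective
  have hjac : (s : Set (R ⧸ P)) ⊆ Ring.jacobson (R ⧸ P) := by
    intro z hz
    simp only [hs, Finset.mem_coe, List.mem_toFinset, List.mem_map] at hz
    obtain ⟨y, hy, rfl⟩ := hz
    rw [SetLike.mem_coe, IsLocalRing.ringJacobson_eq_maximalIdeal, mem_maximalIdeal,
      mem_nonunits_iff]
    intro h
    have := IsLocalHom.of_surjective _ (Ideal.Quotient.mk_surjective (I := P))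
    have := (isUnit_map_iff (Ideal.Quotient.mk P) y).1 h
    exact (mem_maximalIdeal y).1 (hm y hy) this
  have h := ringKrullDim_le_ringKrullDim_quotient_add_card s hjac
  have h0 : ringKrullDim ((R ⧸ P) ⧸ Ideal.span (s : Set (R ⧸ P))) ≤ 0 := by
    have : Ring.KrullDimLE 0 ((R ⧸ P) ⧸ Ideal.span (s : Set (R ⧸ P))) := by
      refine .mk₀ fun I hI => ?_
      let f : R →+* (R ⧸ P) ⧸ Ideal.span (s : Set (R ⧸ P)) :=
        (Ideal.Quotient.mk _).comp (Ideal.Quotient.mk P)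
      have hf : Function.Surjective f :=
        Ideal.Quotient.mk_surjective.comp Ideal.Quotient.mk_surjective
      have hc : I.comap f = maximalIdeal R := by
        refine hQ _ (hI.comap f) (fun a ha => ?_) fun y hy => ?_
        · simp [f, Ideal.mem_comap, Ideal.Quotient.eq_zero_iff_mem.2 ha]
        · rw [Ideal.mem_comap, show f y = 0 from
            Ideal.Quotient.eq_zero_iff_mem.2 (Ideal.subset_span (hmem y hy))]
          exact I.zero_mem
      rw [← Ideal.map_comap_of_surjective f hf I, hc]
      refine (Ideal.map_eq_top_or_isMaximal_of_surjective f hf inferInstance).resolve_left ?_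
      rw [← hc, Ideal.map_comap_of_surjective f hf I]
      exact hI.ne_top
    exact_mod_cast Ring.krullDimLE_iff.1 this
  calc ringKrullDim (R ⧸ P) ≤ 0 + (s.card : WithBot ℕ∞) := h.trans (by gcongr)
    _ ≤ ys.length := by
      rw [zero_add]
      exact_mod_cast (List.toFinset_card_le _).trans_eq (List.length_map _)

/-- If a finite module over a Noetherian local ring has a regular sequence at least as long as a
sequence `ys` whose zero locus on the support is the closed point, then `ys` is weakly regular. -/
theorem isWeaklyRegular_of_forall_eq_maximalIdeal {M : Type u} [AddCommGroup M] [Module R M]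
    [Module.Finite R M] [Nontrivial M] {rs ys : List R} (hrs : IsRegular M rs)
    (hrm : ∀ r ∈ rs, r ∈ maximalIdeal R) (hym : ∀ y ∈ ys, y ∈ maximalIdeal R)
    (hlen : ys.length ≤ rs.length)
    (hQ : ∀ Q : Ideal R, Q.IsPrime → Module.annihilator R M ≤ Q → (∀ y ∈ ys, y ∈ Q) →
      Q = maximalIdeal R) : IsWeaklyRegular M ys := by
  induction ys generalizing M rs with
  | nil => exact .nil R M
  | cons y ys ih =>
    have hreg : IsSMulRegular M y := by
      by_contra hy
      have : y ∈ ⋃ p ∈ associatedPrimes R M, (p : Set R) := by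
        rw [biUnion_associatedPrimes_eq_compl_regular]
        exact hy
      obtain ⟨P, hP, hyP⟩ := Set.mem_iUnion₂.1 this
      have := hP.isPrime
      have h1 := length_le_ringKrullDim_quotient_of_mem_associatedPrimes hrs.1 hrm hP
      have h2 := ringKrullDim_quotient_le_length_s2 (P := P) (ys := ys)
        (fun z hz => hym z (by simp [hz])) fun Q hQp hPQ hys =>
          hQ Q hQp
            (fun a ha => hPQ (hP.annihilator_le (Submodule.mem_annihilator.2 fun v _ =>
              Module.mem_annihilator.1 ha v))) (by simpa using ⟨hPQ hyP, hys⟩)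
      have h3 : rs.length ≤ ys.length := by exact_mod_cast h1.trans h2
      simp only [List.length_cons] at hlen
      omega
    rw [isWeaklyRegular_cons_iff]
    refine ⟨hreg, ?_⟩
    have hntr : Nontrivial (QuotSMulTop y M) :=
      nontrivial_quotSMulTop_of_mem_maximalIdeal M (hym y (by simp))
    let k := ModuleCat.of R (R ⧸ maximalIdeal R)
    have hsupp : Module.support R k = PrimeSpectrum.zeroLocus (maximalIdeal R : Set R) := by
      rw [Module.support_eq_zeroLocus, Ideal.annihilator_quotient]
    have hlt (N : Type u) [AddCommGroup N] [Module R N] [Module.Finite R N] [Nontrivial N] :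
        maximalIdeal R • (⊤ : Submodule R N) < ⊤ :=
      (Submodule.top_ne_ideal_smul_of_le_jacobson_annihilator
        (IsLocalRing.maximalIdeal_le_jacobson _)).symm.lt_top
    have hext := ModuleCat.subsingleton_ext_of_exists_isRegular (maximalIdeal R) k hsupp.subset
      (ModuleCat.of R M) (hlt M) rs hrm hrs
    have hext' : ∀ i < ys.length,
        Subsingleton (Ext k (ModuleCat.of R (QuotSMulTop y M)) i) := by
      intro i hi
      simp only [List.length_cons] at hlen
      have zero1 := AddCommGrpCat.isZero_of_iff_subsingleton.mpr (hext i (by omega))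
      have zero2 := AddCommGrpCat.isZero_of_iff_subsingleton.mpr (hext (i + 1) (by omega))
      exact AddCommGrpCat.subsingleton_of_isZero <| ShortComplex.Exact.isZero_of_both_zeros
        ((Ext.covariant_sequence_exact₃' k
          (IsSMulRegular.smulShortComplex_shortExact (M := ModuleCat.of R M) hreg)) i (i + 1) rfl)
        (zero1.eq_zero_of_src _) (zero2.eq_zero_of_tgt _)
    obtain ⟨ts, htl, htm, ht⟩ := ModuleCat.exists_isRegular_of_exists_subsingleton_ext
      (maximalIdeal R) ys.length (ModuleCat.of R (QuotSMulTop y M)) (hlt _) k hsupp hext'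
    refine ih (rs := ts) ht htm (fun z hz => hym z (by simp [hz])) htl.ge ?_
    intro Q hQp hann hys
    refine hQ Q hQp (le_trans ?_ hann) ?_
    · exact (Submodule.mkQ _).annihilator_le_of_surjective (Submodule.mkQ_surjective _)
    · have : y ∈ Module.annihilator R (QuotSMulTop y M) := by
        rw [Module.mem_annihilator]
        intro v
        obtain ⟨v, rfl⟩ := Submodule.Quotient.mk_surjective _ v
        rw [← Submodule.Quotient.mk_smul, Submodule.Quotient.mk_eq_zero]
        exact Submodule.smul_mem_pointwise_smul _ _ _ trivial
      simpa using ⟨hann this, hys⟩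

end SystemOfParameters

section PowerSeriesRegular

open RingTheory.Sequence Pointwise

theorem PowerSeries.isWeaklyRegular_X_cons {A : Type*} [CommRing A] {ts : List A}
    (h : IsWeaklyRegular A ts) :
    IsWeaklyRegular (PowerSeries A) (PowerSeries.X :: ts.map PowerSeries.C) := by
  have hmem (f : PowerSeries A) :
      f ∈ (PowerSeries.X : PowerSeries A) • (⊤ : Submodule (PowerSeries A) (PowerSeries A)) ↔
        PowerSeries.constantCoeff f = 0 := by
    rw [← PowerSeries.X_dvd_iff]
    refine ⟨?_, ?_⟩
    · rintro ⟨g, -, rfl⟩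
      exact ⟨g, rfl⟩
    · rintro ⟨g, rfl⟩
      exact Submodule.smul_mem_pointwise_smul g _ _ trivial
  rw [isWeaklyRegular_cons_iff]
  refine ⟨fun f g hfg => PowerSeries.X_mul_cancel hfg, ?_⟩
  let φ : A →+ QuotSMulTop (PowerSeries.X : PowerSeries A) (PowerSeries A) :=
    (Submodule.mkQ _).toAddMonoidHom.comp (PowerSeries.C (R := A)).toAddMonoidHom
  have hφ (a : A) : φ a = Submodule.Quotient.mk (PowerSeries.C a) := rfl
  have hb : Function.Bijective φ := by
    refine ⟨(injective_iff_map_eq_zero φ).2 fun a ha => ?_, fun y => ?_⟩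
    · rw [hφ, Submodule.Quotient.mk_eq_zero, hmem] at ha
      simpa using ha
    · obtain ⟨f, rfl⟩ := Submodule.Quotient.mk_surjective _ y
      refine ⟨PowerSeries.constantCoeff f, ?_⟩
      rw [hφ, Submodule.Quotient.eq, hmem]
      simp
  refine ((AddEquiv.ofBijective φ hb).isWeaklyRegular_congr ?_).1 h
  refine List.forall₂_map_right_iff.mpr <| List.forall₂_same.mpr fun r _ x => ?_
  change φ (r • x) = PowerSeries.C r • φ x
  rw [hφ, hφ, ← Submodule.Quotient.mk_smul]
  simp

theorem RingEquiv.isWeaklyRegular_map {A B : Type*} [CommRing A] [CommRing B] (e : A ≃+* B)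
    {ts : List A} (h : IsWeaklyRegular A ts) : IsWeaklyRegular B (ts.map e) :=
  (e.toAddEquiv.isWeaklyRegular_congr <| List.forall₂_map_right_iff.mpr <|
    List.forall₂_same.mpr fun r _ x => map_mul e r x).1 h

theorem MvPowerSeries.exists_isWeaklyRegular {A : Type*} [CommRing A] [Nontrivial A] {ts : List A}
    (h : IsWeaklyRegular A ts) (hts : ∀ t ∈ ts, ¬ IsUnit t) (σ : Type*) [Finite σ] :
    ∃ us : List (MvPowerSeries σ A), IsWeaklyRegular (MvPowerSeries σ A) us ∧
      (∀ u ∈ us, ¬ IsUnit u) ∧ us.length = ts.length + Nat.card σ := by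
  induction σ using Finite.induction_empty_option with
  | of_equiv e ih =>
    obtain ⟨us, hus, hu, hl⟩ := ih
    let E := (renameEquiv A e).toRingEquiv
    refine ⟨us.map E, E.isWeaklyRegular_map hus, ?_, by
      rw [List.length_map, hl, Nat.card_congr e]⟩
    simp only [List.mem_map, forall_exists_index, and_imp, forall_apply_eq_imp_iff₂]
    exact fun u hm h' => hu u hm ((MulEquiv.isUnit_map E).1 h')
  | h_empty =>
    let E := (isEmptyEquiv (σ := PEmpty) (R := A)).toRingEquiv.symm
    refine ⟨ts.map E, E.isWeaklyRegular_map h, ?_, by simp⟩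
    simp only [List.mem_map, forall_exists_index, and_imp, forall_apply_eq_imp_iff₂]
    exact fun u hm h' => hts u hm ((MulEquiv.isUnit_map E).1 h')
  | @h_option σ _ ih =>
    obtain ⟨us, hus, hu, hl⟩ := ih
    let E := (optionEquivLeft σ A).toRingEquiv.symm
    refine ⟨(PowerSeries.X :: us.map PowerSeries.C).map E,
      E.isWeaklyRegular_map (PowerSeries.isWeaklyRegular_X_cons hus), ?_, ?_⟩
    · simp only [List.mem_map, forall_exists_index, and_imp, forall_apply_eq_imp_iff₂,
        MulEquiv.isUnit_map]
      rintro v (_ | ⟨_, hv⟩)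
      · exact fun h' => by simpa using PowerSeries.isUnit_constantCoeff _ h'
      · obtain ⟨u, hm, rfl⟩ := List.mem_map.1 hv
        intro h'
        exact hu u hm (by simpa using h'.map PowerSeries.constantCoeff)
    · simp [hl, add_assoc]

end PowerSeriesRegular

section MatrixParameters

open Matrix Polynomial IntermediateField

universe u

variable {k K : Type*} [Field k] [Field K] [Algebra k K]

lemma Matrix.mul_aeval_eq_aeval_mul {m n : Type*} [Fintype m] [DecidableEq m] [Fintype n]
    [DecidableEq n] {X : Matrix m n K} {M : Matrix m m K} {N : Matrix n n K}
    (h : X * N = M * X) (φ : k[X]) : X * aeval N φ = aeval M φ * X := by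
  induction φ using Polynomial.induction_on' with
  | add p q hp hq => simp [Matrix.mul_add, Matrix.add_mul, hp, hq]
  | monomial i a =>
    have hpow : X * N ^ i = M ^ i * X := by
      induction i with
      | zero => simp
      | succ i ih => rw [pow_succ, ← Matrix.mul_assoc, ih, Matrix.mul_assoc, h, pow_succ,
          Matrix.mul_assoc]
    simp [aeval_monomial, Algebra.algebraMap_eq_smul_one, hpow]

lemma IsNilpotent.isUnit_aeval {R : Type*} [Ring R] [Algebra k R] {x : R} (hx : IsNilpotent x)
    {φ : k[X]} (hφ : φ.coeff 0 ≠ 0) : IsUnit (aeval x φ) := by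
  rw [← Polynomial.divX_mul_X_add φ, map_add, map_mul, aeval_X, aeval_C]
  have hu : IsUnit (algebraMap k R (φ.coeff 0)) := (IsUnit.mk0 _ hφ).map _
  have hc : Commute (aeval x φ.divX) x := by
    simpa using (Commute.all φ.divX X).map (aeval x)
  exact (hc.isNilpotent_mul_left hx).isUnit_add_right_of_commute hu
    (Algebra.commutes _ _).symm

lemma Matrix.exists_row_basis {m n : Type*} [Fintype m] (N : Matrix m n K) :
    ∃ p : m → Prop, LinearIndependent K (fun i : {i // p i} => N i) ∧
      ∃ P : Matrix {i // ¬ p i} {i // p i} K,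
        ∀ i : {i // ¬ p i}, N i = ∑ᶠ j, P i j • N j := by
  classical
  obtain ⟨b, -, -, hb, hli⟩ := exists_linearIndepOn_extension (K := K) (v := N)
    (linearIndepOn_empty K N) (Set.empty_subset Set.univ)
  refine ⟨(· ∈ b), hli, ?_⟩
  have h : ∀ i, ∃ c : {i // i ∈ b} → K, ∑ j, c j • N j = N i := by
    intro i
    have := hb (Set.mem_image_of_mem N (Set.mem_univ i))
    have hr : N '' b = Set.range fun j : {i // i ∈ b} => N j :=
      Set.ext fun x => ⟨fun ⟨j, hj, h⟩ => ⟨⟨j, hj⟩, h⟩, fun ⟨j, h⟩ => ⟨j, j.2, h⟩⟩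
    rw [hr] at this
    exact (Submodule.mem_span_range_iff_exists_fun K).1 this
  choose P hP using h
  refine ⟨Matrix.of fun i j => P i j, fun i => ?_⟩
  rw [finsum_eq_sum_of_fintype]
  exact (hP i).symm

lemma Matrix.exists_isUnit_submatrix {m n : Type*} [Fintype m] [DecidableEq m] [Fintype n]
    {M : Matrix m n K} (hM : LinearIndependent K M.row) :
    ∃ e : m → n, Function.Injective e ∧ IsUnit (M.submatrix id e) := by
  classical
  obtain ⟨κ, a, ha, hspan, hli⟩ := exists_linearIndependent' K M.col
  have : Finite κ := Finite.of_injective a ha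
  have := Fintype.ofFinite κ
  have hcard : Fintype.card κ = Fintype.card m := by
    rw [← finrank_span_eq_card hli, hspan, ← Matrix.rank_eq_finrank_span_cols, hM.rank_matrix]
  let f : m ≃ κ := (Fintype.equivOfCardEq hcard).symm
  refine ⟨a ∘ f, ha.comp f.injective, ?_⟩
  rw [← Matrix.linearIndependent_cols_iff_isUnit]
  exact hli.comp f f.injective

lemma IntermediateField.inv_apply_mem {m : Type*} [Fintype m] [DecidableEq m]
    (F : IntermediateField k K) {M : Matrix m m K} (hM : ∀ i j, M i j ∈ F) (i j : m) :
    M⁻¹ i j ∈ F := by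
  obtain ⟨M, rfl⟩ : ∃ M' : Matrix m m F, M'.map (algebraMap F K) = M :=
    ⟨Matrix.of fun i j => ⟨M i j, hM i j⟩, rfl⟩
  by_cases h : IsUnit M.det
  · have : (M.map (algebraMap F K))⁻¹ = M⁻¹.map (algebraMap F K) := by
      apply Matrix.inv_eq_left_inv
      rw [← Matrix.map_mul, Matrix.nonsing_inv_mul _ h, Matrix.map_one _ (map_zero _) (map_one _)]
    rw [this]
    exact (M⁻¹ i j).2
  · have h' : ¬ IsUnit (M.map (algebraMap F K)).det := by
      have : (M.map (algebraMap F K)).det = algebraMap F K M.det := by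
        rw [RingHom.map_det]; rfl
      rw [this]
      simpa using h
    rw [Matrix.nonsing_inv_apply_not_isUnit _ h']
    exact F.zero_mem

lemma IntermediateField.mul_apply_mem {l m n : Type*} [Fintype m]
    (F : IntermediateField k K) {M : Matrix l m K} {N : Matrix m n K} (hM : ∀ i j, M i j ∈ F)
    (hN : ∀ i j, N i j ∈ F) (i j) : (M * N) i j ∈ F := by
  rw [Matrix.mul_apply]
  exact sum_mem fun x _ => mul_mem (hM _ _) (hN _ _)

lemma IntermediateField.aeval_apply_mem {m : Type*} [Fintype m] [DecidableEq m]
    (F : IntermediateField k K) {M : Matrix m m K} (hM : ∀ i j, M i j ∈ F) (φ : k[X]) (i j : m) :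
    aeval M φ i j ∈ F :=
  Algebra.adjoin_singleton_le (S := F.toSubalgebra.matrix) hM (aeval_mem_adjoin_singleton k M) i j

/-- A solution of a linear system of full row rank with coefficients in a field `F` is defined
over the field generated over `F` by the values of its free variables. -/
lemma Matrix.exists_finset_free_variables {m n l : Type*} [Fintype m] [Fintype n] [Fintype l]
    {M : Matrix m n K} (hM : LinearIndependent K M.row) (x : Matrix n l K) :
    ∃ s : Finset K, s.card ≤ (Fintype.card n - Fintype.card m) * Fintype.card l ∧
      ∀ F : IntermediateField k K, (s : Set K) ⊆ F → (∀ i j, M i j ∈ F) →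
        (∀ i j, (M * x) i j ∈ F) → ∀ i j, x i j ∈ F := by
  classical
  obtain ⟨e, he, hu⟩ := Matrix.exists_isUnit_submatrix hM
  refine ⟨((Finset.univ.image e)ᶜ ×ˢ Finset.univ).image fun ij => x ij.1 ij.2, ?_, ?_⟩
  · refine Finset.card_image_le.trans ?_
    rw [Finset.card_product, Finset.card_compl, Finset.card_image_of_injective _ he]
    rfl
  · intro F hs hMF hMx
    have hfree : ∀ i j, i ∉ Set.range e → x i j ∈ F := fun i j hi => hs (by
      simp only [Finset.coe_image, Set.mem_image]
      exact ⟨(i, j), by simpa using hi, rfl⟩)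
    let x₀ : Matrix n l K := Matrix.of fun i j => if i ∈ Set.range e then 0 else x i j
    have hx₀ : ∀ i j, x₀ i j ∈ F := by
      intro i j
      simp only [x₀, Matrix.of_apply]
      split_ifs with h
      · exact F.zero_mem
      · exact hfree i j h
    have key : M.submatrix id e * x.submatrix e id = M * x - M * x₀ := by
      ext i j
      rw [← Matrix.mul_sub, Matrix.mul_apply, Matrix.mul_apply,
        ← Finset.sum_subset (Finset.subset_univ (Finset.univ.image e)),
        Finset.sum_image he.injOn]
      · simp [x₀]
      · intro i' _ hi'
        have : ¬ ∃ y, e y = i' := by simpa using hi'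
        simp [x₀, this]
    have hsol : x.submatrix e id = (M.submatrix id e)⁻¹ * (M * x - M * x₀) := by
      rw [← key, ← Matrix.mul_assoc,
        Matrix.nonsing_inv_mul _ ((Matrix.isUnit_iff_isUnit_det _).1 hu), Matrix.one_mul]
    intro i j
    by_cases hi : i ∈ Set.range e
    · obtain ⟨i, rfl⟩ := hi
      have : x (e i) j = (x.submatrix e id) i j := rfl
      rw [this, hsol]
      refine F.mul_apply_mem (F.inv_apply_mem fun _ _ => hMF _ _) (fun i j => ?_) i j
      exact sub_mem (hMx i j) (F.mul_apply_mem hMF hx₀ i j)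
    · exact hfree i j hi

/-- Block form of a matrix `N` whose rows are spanned by linearly independent rows `A`, and of a
matrix `g` intertwining `N` with `N * aeval N φ`: the pair is determined by a pair of the same kind
on the smaller index type and by `(card ρ + card τ) ^ 2 - card ρ ^ 2` further scalars. -/
lemma Matrix.exists_finset_of_fromRows {ρ τ : Type u} [Fintype ρ] [DecidableEq ρ] [Fintype τ]
    [DecidableEq τ] {φ : k[X]} (hφ : φ.coeff 0 ≠ 0) {N g : Matrix (ρ ⊕ τ) (ρ ⊕ τ) K}
    {A : Matrix ρ (ρ ⊕ τ) K} {P : Matrix τ ρ K} (hNA : N = fromRows A (P * A))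
    (hA : LinearIndependent K A.row) (hN : IsNilpotent N) (hg : g * N = N * aeval N φ * g)
    (ih : ∀ N g : Matrix ρ ρ K, IsNilpotent N → g * N = N * aeval N φ * g →
      ∃ s : Finset K, s.card ≤ Fintype.card ρ ^ 2 ∧ (∀ i j, N i j ∈ adjoin k (s : Set K)) ∧
        ∀ i j, g i j ∈ adjoin k (s : Set K)) :
    ∃ s : Finset K, s.card ≤ (Fintype.card ρ + Fintype.card τ) ^ 2 ∧
      (∀ i j, N i j ∈ adjoin k (s : Set K)) ∧ ∀ i j, g i j ∈ adjoin k (s : Set K) := by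
  classical
  let L : Matrix (ρ ⊕ τ) (ρ ⊕ τ) K := fromBlocks 1 0 P 1
  let L' : Matrix (ρ ⊕ τ) (ρ ⊕ τ) K := fromBlocks 1 0 (-P) 1
  have hLL' : L * L' = 1 := by simp [L, L', fromBlocks_multiply]
  have hL'L : L' * L = 1 := by simp [L, L', fromBlocks_multiply]
  let E : Matrix (ρ ⊕ τ) ρ K := fromRows 1 0
  let A₁ := A * L
  let N' : Matrix ρ ρ K := A₁.toCols₁
  let B : Matrix ρ τ K := A₁.toCols₂
  let N₁ := L' * N * L
  let g₁ := L' * g * L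
  let a := g₁.toBlocks₁₁
  let b := g₁.toBlocks₁₂
  let c := g₁.toBlocks₂₁
  let d := g₁.toBlocks₂₂
  have hA₁ : A₁ = fromCols N' B := (fromCols_toCols A₁).symm
  have hg₁ : g₁ = fromBlocks a b c d := (fromBlocks_toBlocks g₁).symm
  have hNE : N = L * E * A := by
    rw [hNA]
    simp [L, E, fromBlocks_mul_fromRows, fromRows_mul]
  have hN₁E : N₁ = E * A₁ := by
    simp only [N₁, A₁]
    rw [hNE]
    simp only [← Matrix.mul_assoc, hL'L, Matrix.one_mul]
  have hN₁ : L * N₁ = N * L := by simp only [N₁, ← Matrix.mul_assoc, hLL', Matrix.one_mul]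
  have hNL : N = L * N₁ * L' := by rw [hN₁, Matrix.mul_assoc, hLL', Matrix.mul_one]
  have hgL : g = L * g₁ * L' := by
    simp only [g₁, ← Matrix.mul_assoc, hLL', Matrix.one_mul]
    rw [Matrix.mul_assoc, hLL', Matrix.mul_one]
  have hA₁E : A₁ * E = N' := by rw [hA₁]; simp [E, fromCols_mul_fromRows]
  have hA₁N₁ : A₁ * N₁ = N' * A₁ := by rw [hN₁E, ← Matrix.mul_assoc, hA₁E]
  have hrel : g₁ * N₁ = N₁ * aeval N₁ φ * g₁ := by
    have h1 : aeval N₁ φ * L' = L' * aeval N φ := by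
      refine (mul_aeval_eq_aeval_mul ?_ φ).symm
      simp only [N₁, Matrix.mul_assoc, hLL', Matrix.mul_one]
    calc g₁ * N₁ = L' * g * (L * L') * N * L := by simp only [g₁, N₁, Matrix.mul_assoc]
      _ = L' * (g * N) * L := by rw [hLL']; simp only [Matrix.mul_assoc, Matrix.one_mul]
      _ = L' * N * (1 * aeval N φ) * g * L := by
        rw [hg]; simp only [Matrix.mul_assoc, Matrix.one_mul]
      _ = L' * N * L * (L' * aeval N φ) * g * L := by
        rw [← hLL']; simp only [Matrix.mul_assoc]
      _ = N₁ * aeval N₁ φ * g₁ := by rw [← h1]; simp only [g₁, N₁, Matrix.mul_assoc]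
  have hA₁ind : LinearIndependent K A₁.row := by
    have hinj : Function.Injective (vecMul · A) := vecMul_injective_iff.2 hA
    refine vecMul_injective_iff.1 fun v w hvw => hinj ?_
    have := congrArg (vecMul · L') hvw
    simpa [A₁, vecMul_vecMul, Matrix.mul_assoc, hLL'] using this
  have hcancel : ∀ {l : Type u} (X Y : Matrix l ρ K), X * A₁ = Y * A₁ → X = Y := by
    intro l X Y h
    have hrow : ∀ i, X i = Y i := fun i => vecMul_injective_iff.2 hA₁ind (congrFun h i)
    exact funext hrow
  let Φ := aeval N' φ
  have hN' : IsNilpotent N' := by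
    obtain ⟨i, hi⟩ := hN
    refine ⟨i, hcancel _ _ ?_⟩
    have h1 := mul_aeval_eq_aeval_mul hA₁N₁ (X ^ i : k[X])
    have h2 := mul_aeval_eq_aeval_mul hN₁ (X ^ i : k[X])
    simp only [map_pow, aeval_X] at h1 h2
    have h3 : N₁ ^ i = 0 := by
      rw [← Matrix.one_mul (N₁ ^ i), ← hL'L, Matrix.mul_assoc, h2, hi]
      simp
    rw [← h1, h3]
    simp
  have hΦ : IsUnit Φ.det := (Matrix.isUnit_iff_isUnit_det _).1 (hN'.isUnit_aeval hφ)
  have hblocks : fromRows (a * A₁) (c * A₁) = fromRows (Φ * (A₁ * g₁)) 0 := by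
    calc fromRows (a * A₁) (c * A₁) = g₁ * E * A₁ := by
          rw [hg₁]; simp [E, fromBlocks_mul_fromRows, fromRows_mul]
      _ = E * (A₁ * aeval N₁ φ) * g₁ := by
          rw [Matrix.mul_assoc, ← hN₁E, hrel]; nth_rw 1 [hN₁E]; simp only [Matrix.mul_assoc]
      _ = E * (Φ * (A₁ * g₁)) := by
          rw [mul_aeval_eq_aeval_mul hA₁N₁]; simp only [Φ, Matrix.mul_assoc]
      _ = fromRows (Φ * (A₁ * g₁)) 0 := by simp [E, fromRows_mul]
  obtain ⟨ha, hc⟩ := fromRows_inj hblocks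
  have hc0 : c = 0 := hcancel _ _ (by rw [hc, Matrix.zero_mul])
  have hcols : fromCols (a * N') (a * B) =
      fromCols (Φ * (N' * a)) (Φ * (A₁ * fromRows b d)) := by
    rw [← mul_fromCols, ← hA₁, ha, ← mul_fromCols]
    congr 1
    rw [hg₁, hc0, hA₁]
    simp [fromCols_mul_fromBlocks, fromCols_mul_fromRows]
  obtain ⟨h11, h12⟩ := fromCols_inj hcols
  have hcomm : Φ * N' = N' * Φ := (mul_aeval_eq_aeval_mul rfl φ).symm
  obtain ⟨s₁, hs₁, hs₁N, hs₁a⟩ := ih N' a hN' (by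
    rw [h11, ← Matrix.mul_assoc, hcomm])
  obtain ⟨s₂, hs₂, hs₂x⟩ := exists_finset_free_variables (k := k) hA₁ind (fromRows b d)
  let s₃ : Finset K := Finset.univ.image fun ij : ρ × τ => B ij.1 ij.2
  let s₄ : Finset K := Finset.univ.image fun ij : τ × ρ => P ij.1 ij.2
  have hs₃ : s₃.card ≤ Fintype.card ρ * Fintype.card τ :=
    Finset.card_image_le.trans (by simp)
  have hs₄ : s₄.card ≤ Fintype.card τ * Fintype.card ρ :=
    Finset.card_image_le.trans (by simp)
  let s := s₁ ∪ s₂ ∪ s₃ ∪ s₄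
  let F := adjoin k (s : Set K)
  have hsF : (s : Set K) ⊆ F := subset_adjoin k _
  have hs₁s : (s₁ : Set K) ⊆ s := by intro x hx; simp_all [s]
  have hs₂s : (s₂ : Set K) ⊆ s := by intro x hx; simp_all [s]
  have hs₃s : (s₃ : Set K) ⊆ s := by intro x hx; simp_all [s]
  have hs₄s : (s₄ : Set K) ⊆ s := by intro x hx; simp_all [s]
  have hN'F : ∀ i j, N' i j ∈ F := fun i j => adjoin.mono k _ _ hs₁s (hs₁N i j)
  have haF : ∀ i j, a i j ∈ F := fun i j => adjoin.mono k _ _ hs₁s (hs₁a i j)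
  have hBF : ∀ i j, B i j ∈ F := fun i j =>
    hsF (hs₃s (Finset.mem_coe.2 (Finset.mem_image_of_mem _ (Finset.mem_univ (i, j)))))
  have hPF : ∀ i j, P i j ∈ F := fun i j =>
    hsF (hs₄s (Finset.mem_coe.2 (Finset.mem_image_of_mem _ (Finset.mem_univ (i, j)))))
  have hA₁F : ∀ i j, A₁ i j ∈ F := by
    rw [hA₁]
    rintro i (j | j)
    · exact hN'F i j
    · exact hBF i j
  have hxF : ∀ i j, fromRows b d i j ∈ F := by
    refine hs₂x F (hs₂s.trans hsF) hA₁F ?_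
    have : A₁ * fromRows b d = Φ⁻¹ * (a * B) := by
      rw [h12, ← Matrix.mul_assoc Φ⁻¹, Matrix.nonsing_inv_mul _ hΦ, Matrix.one_mul]
    rw [this]
    exact F.mul_apply_mem (F.inv_apply_mem (F.aeval_apply_mem hN'F φ)) (F.mul_apply_mem haF hBF)
  have hone : ∀ {l : Type u} [DecidableEq l] (i j : l), (1 : Matrix l l K) i j ∈ F := by
    intro l _ i j
    rw [Matrix.one_apply]
    split_ifs
    exacts [F.one_mem, F.zero_mem]
  have hLF : ∀ i j, L i j ∈ F := by
    rintro (i | i) (j | j)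
    exacts [hone i j, F.zero_mem, hPF i j, hone i j]
  have hL'F : ∀ i j, L' i j ∈ F := by
    rintro (i | i) (j | j)
    exacts [hone i j, F.zero_mem, F.neg_mem (hPF i j), hone i j]
  refine ⟨s, ?_, fun i j => ?_, fun i j => ?_⟩
  · have h1 : s.card ≤ s₁.card + s₂.card + s₃.card + s₄.card :=
      (Finset.card_union_le _ _).trans (Nat.add_le_add_right ((Finset.card_union_le _ _).trans
        (Nat.add_le_add_right (Finset.card_union_le _ _) _)) _)
    have h2 : s₂.card ≤ Fintype.card τ * Fintype.card τ := by simpa using hs₂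
    nlinarith
  · rw [hNL, hN₁E]
    refine F.mul_apply_mem (F.mul_apply_mem hLF (F.mul_apply_mem ?_ hA₁F)) hL'F i j
    rintro (i | i) j
    exacts [hone i j, F.zero_mem]
  · rw [hgL, hg₁]
    refine F.mul_apply_mem (F.mul_apply_mem hLF ?_) hL'F i j
    rintro (i | i) (j | j)
    exacts [haF i j, hxF (.inl i) j, by rw [hc0]; exact F.zero_mem, hxF (.inr i) j]

theorem Matrix.exists_finset_card_le_sq {φ : k[X]} (hφ : φ.coeff 0 ≠ 0) {ι : Type u} [Fintype ι]
    [DecidableEq ι] (N g : Matrix ι ι K) (hN : IsNilpotent N)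
    (hg : g * N = N * aeval N φ * g) :
    ∃ s : Finset K, s.card ≤ Fintype.card ι ^ 2 ∧ (∀ i j, N i j ∈ adjoin k (s : Set K)) ∧
      ∀ i j, g i j ∈ adjoin k (s : Set K) := by
  classical
  induction hn : Fintype.card ι using Nat.strong_induction_on generalizing ι with
  | _ n ih =>
  obtain ⟨p, hli, P, hP⟩ := N.exists_row_basis
  let e : {i // p i} ⊕ {i // ¬ p i} ≃ ι := Equiv.sumCompl p
  have hcard : Fintype.card {i // p i} + Fintype.card {i // ¬ p i} = n := by
    rw [← hn, ← Fintype.card_congr e, Fintype.card_sum]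
  have hlt : 0 < n → Fintype.card {i // p i} < n := by
    intro hpos
    by_contra hge
    have hz : Fintype.card {i // ¬ p i} = 0 := by omega
    have hall : ∀ i, p i := by
      intro i
      by_contra hi
      exact (Fintype.card_eq_zero_iff.1 hz).elim ⟨i, hi⟩
    have hli' : LinearIndependent K N.row :=
      hli.comp (fun i => ⟨i, hall i⟩) fun i j hij => congrArg Subtype.val hij
    have hu : IsUnit N := Matrix.linearIndependent_rows_iff_isUnit.1 hli'
    have : Nonempty ι := Fintype.card_pos_iff.1 (hn ▸ hpos)
    exact hN.not_isUnit hu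
  rcases Nat.eq_zero_or_pos n with rfl | hpos
  · have : IsEmpty ι := Fintype.card_eq_zero_iff.1 hn
    exact ⟨∅, by simp, isEmptyElim, isEmptyElim⟩
  have hrel : reindexAlgEquiv k K e.symm g * reindexAlgEquiv k K e.symm N =
      reindexAlgEquiv k K e.symm N * aeval (reindexAlgEquiv k K e.symm N) φ *
        reindexAlgEquiv k K e.symm g := by
    rw [← map_mul, hg, map_mul, map_mul]
    congr 2
    exact (Polynomial.aeval_algHom_apply (reindexAlgEquiv k K e.symm).toAlgHom N φ).symm
  let A : Matrix {i // p i} ({i // p i} ⊕ {i // ¬ p i}) K := Matrix.of fun i j => N i (e j)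
  have hNA : reindexAlgEquiv k K e.symm N = fromRows A (P * A) := by
    ext i j
    rcases i with i | i
    · rfl
    · change N i (e j) = _
      rw [hP i, finsum_eq_sum_of_fintype]
      simp [A, Matrix.mul_apply]
  have hA : LinearIndependent K A.row :=
    hli.map' (LinearMap.funLeft K K e) (LinearMap.ker_eq_bot.2
      (LinearMap.funLeft_injective_of_surjective _ _ _ e.surjective))
  obtain ⟨s, hs, hsN, hsg⟩ := exists_finset_of_fromRows hφ hNA hA (hN.map _) hrel
    fun N g hN hg => ih _ (hlt hpos) N g hN hg rfl
  refine ⟨s, hcard ▸ hs, fun i j => ?_, fun i j => ?_⟩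
  · simpa using hsN (e.symm i) (e.symm j)
  · simpa using hsg (e.symm i) (e.symm j)

end MatrixParameters

section UnipotentConjugation

open Polynomial

variable {ι : Type*} [Fintype ι] [DecidableEq ι]

theorem Matrix.isNilpotent_of_spectrum_subset_zero {Ω : Type*} [Field Ω] [IsAlgClosed Ω]
    {B : Matrix ι ι Ω} (h : spectrum Ω B ⊆ {0}) : IsNilpotent B := by
  have hroots : ∀ r ∈ B.charpoly.roots, r = 0 := fun r hr =>
    h (Matrix.mem_spectrum_iff_isRoot_charpoly.2 ((mem_roots'.1 hr).2))
  have hprod := (IsAlgClosed.splits B.charpoly).eq_prod_roots_of_monic B.charpoly_monic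
  rw [Multiset.eq_replicate_of_mem hroots] at hprod
  simp only [Multiset.map_replicate, map_zero, sub_zero, Multiset.prod_replicate] at hprod
  have := Matrix.aeval_self_charpoly B
  rw [hprod, map_pow, aeval_X] at this
  exact ⟨_, this⟩

theorem Matrix.exists_isNilpotent_pow_sub_one {Ω : Type*} [Field Ω] [IsAlgClosed Ω]
    {A g : Matrix ι ι Ω} (hA : IsUnit A) (hg : IsUnit g) {r : ℕ} (hr : 0 < r)
    (h : g * A = A ^ r * g) :
    ∃ j, 0 < j ∧ IsNilpotent (A ^ (r ^ j - 1) - 1) := by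
  obtain ⟨u, rfl⟩ := hg
  have hspec : spectrum Ω (A ^ r) = spectrum Ω A := by
    rw [← spectrum.units_conjugate (a := A) (u := u), h, mul_assoc, Units.mul_inv, mul_one]
  rw [spectrum.map_pow_of_pos A hr] at hspec
  let f : spectrum Ω A → spectrum Ω A :=
    fun x => ⟨x.1 ^ r, hspec.subset (Set.mem_image_of_mem _ x.2)⟩
  have hsurj : Function.Surjective f := by
    rintro ⟨y, hy⟩
    rw [← hspec] at hy
    obtain ⟨x, hx, rfl⟩ := hy
    exact ⟨⟨x, hx⟩, rfl⟩
  have hbij := Finite.surjective_iff_bijective.1 hsurj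
  let σ := Equiv.ofBijective f hbij
  obtain ⟨j, hj, hσ⟩ := (isOfFinOrder_iff_pow_eq_one).1 (isOfFinOrder_of_finite σ)
  have hiter (i : ℕ) (x : spectrum Ω A) : (((σ ^ i) x : spectrum Ω A) : Ω) = x.1 ^ r ^ i := by
    induction i with
    | zero => simp
    | succ i ih =>
      rw [pow_succ', Equiv.Perm.mul_apply, pow_succ, pow_mul, ← ih]
      rfl
  refine ⟨j, hj, Matrix.isNilpotent_of_spectrum_subset_zero ?_⟩
  rcases isEmpty_or_nonempty ι with hι | hι
  · simp [spectrum.of_subsingleton]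
  have hne : (spectrum Ω A).Nonempty := spectrum.nonempty_of_isAlgClosed_of_finiteDimensional Ω A
  have hmap := spectrum.map_polynomial_aeval_of_nonempty A (X ^ (r ^ j - 1) - 1 : Polynomial Ω) hne
  simp only [map_sub, map_pow, aeval_X, map_one] at hmap
  rw [hmap]
  rintro _ ⟨x, hx, rfl⟩
  have hx0 : x ≠ 0 := by
    rintro rfl
    exact spectrum.zero_notMem Ω hA hx
  have := hiter j ⟨x, hx⟩
  rw [hσ] at this
  have hpos : 0 < r ^ j := by positivity
  have h1 : x ^ (r ^ j - 1) = 1 := by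
    refine mul_left_cancel₀ hx0 ?_
    rw [← pow_succ', Nat.sub_add_cancel hpos, mul_one]
    exact this.symm
  simp [h1]

theorem Matrix.isUnit_map_of_map_eq_one {D F Ω : Type*} [CommRing D] [CommRing F]
    [Nontrivial F] [Field Ω] {φ : D →+* Ω} (hφ : Function.Injective φ) (π : D →+* F)
    {g : Matrix ι ι D} (hg : IsUnit (g.map π)) : IsUnit (g.map φ) := by
  rw [Matrix.isUnit_iff_isUnit_det, ← RingHom.mapMatrix_apply, ← RingHom.map_det,
    isUnit_iff_ne_zero, map_ne_zero_iff _ hφ]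
  rintro h0
  rw [Matrix.isUnit_iff_isUnit_det, ← RingHom.mapMatrix_apply, ← RingHom.map_det, h0,
    map_zero] at hg
  exact not_isUnit_zero hg

/-- A matrix congruent to `1` which is conjugate to its `(p ^ s + 1)`-st power over a domain of
characteristic `p` is unipotent. -/
theorem Matrix.isNilpotent_of_conj_eq_pow {p s : ℕ} [Fact p.Prime]
    {D F : Type*} [CommRing D] [IsDomain D] [CharP D p] [CommRing F] [Nontrivial F]
    (π : D →+* F) {N g : Matrix ι ι D} (hN : N.map π = 0) (hg : g.map π = 1)
    (h : g * (1 + N) = (1 + N) ^ (p ^ s + 1) * g) : IsNilpotent N := by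
  have hp : p.Prime := Fact.out
  rcases isEmpty_or_nonempty ι with hι | hι
  · exact ⟨1, Subsingleton.elim _ _⟩
  let Ω := AlgebraicClosure (FractionRing D)
  let φ : D →+* Ω := (algebraMap (FractionRing D) Ω).comp (algebraMap D (FractionRing D))
  have hφ : Function.Injective φ :=
    (algebraMap (FractionRing D) Ω).injective.comp (IsFractionRing.injective D (FractionRing D))
  set A := 1 + N with hAdef
  have hAπ : π.mapMatrix A = 1 := by
    rw [hAdef, map_add, map_one, RingHom.mapMatrix_apply, hN, add_zero]
  have hAu : IsUnit (A.map φ) :=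
    isUnit_map_of_map_eq_one hφ π (by rw [← RingHom.mapMatrix_apply, hAπ]; exact isUnit_one)
  have hgu : IsUnit (g.map φ) :=
    isUnit_map_of_map_eq_one hφ π (by rw [hg]; exact isUnit_one)
  have hΩ : φ.mapMatrix g * φ.mapMatrix A =
      φ.mapMatrix A ^ (p ^ s + 1) * φ.mapMatrix g := by
    rw [← map_mul, h, map_mul, map_pow]
  have hinj : Function.Injective (φ.mapMatrix : Matrix ι ι D →+* Matrix ι ι Ω) :=
    Matrix.map_injective hφ
  obtain ⟨j, hj, hnil⟩ := exists_isNilpotent_pow_sub_one hAu hgu (Nat.succ_pos _) hΩ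
  set M := (p ^ s + 1) ^ j - 1 with hM
  have hnil' : IsNilpotent (A ^ M - 1) := by
    obtain ⟨c, hc⟩ := hnil
    refine ⟨c, hinj ?_⟩
    rw [map_pow, map_sub, map_pow, map_one, map_zero]
    exact hc
  have hM0 : M ≠ 0 := by
    have : 1 < (p ^ s + 1) ^ j :=
      Nat.one_lt_pow hj.ne' (by have := pow_pos hp.pos s; omega)
    omega
  obtain ⟨a, M', hM', hMa⟩ := Nat.exists_eq_pow_mul_and_not_dvd hM0 p hp.ne_one
  obtain ⟨c, hc⟩ := hnil'
  have hAb : (A ^ p ^ (a + c)) ^ M' = 1 := by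
    have : (A ^ M - 1) ^ p ^ c = 0 := pow_eq_zero_of_le (Nat.lt_pow_self hp.one_lt).le hc
    rw [sub_pow_char_pow_of_commute _ _ (Commute.one_right _), one_pow, sub_eq_zero] at this
    rw [← this, ← pow_mul, ← pow_mul, hMa]
    ring_nf
  set B := A ^ p ^ (a + c) with hB
  have hgeom : (∑ i ∈ Finset.range M', B ^ i) * (B - 1) = 0 := by
    rw [geom_sum_mul, hAb, sub_self]
  set C := ∑ i ∈ Finset.range M', B ^ i with hC
  have hCπ : π.mapMatrix C = (M' : Matrix ι ι F) := by
    simp [hC, hB, map_sum, map_pow, hAπ]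
  have hCF : CharP F p := by
    have h0 : (p : F) = 0 := by
      rw [← map_natCast π p, CharP.cast_eq_zero, map_zero]
    obtain ⟨r, hr⟩ := CharP.exists F
    have hrp : r ∣ p := (CharP.cast_eq_zero_iff F r p).1 h0
    rcases (Nat.dvd_prime hp).1 hrp with rfl | rfl
    · exact (CharP.false_of_nontrivial_of_char_one (R := F)).elim
    · exact hr
  have hM'u : IsUnit (M' : F) := by
    have hcop : Nat.Coprime M' p := ((Nat.Prime.coprime_iff_not_dvd hp).2 hM').symm
    exact (CharP.isUnit_natCast_iff hp).2 hM'
  have hdet : C.det ≠ 0 := by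
    intro h0
    have : π C.det = (M' : F) ^ Fintype.card ι := by
      rw [RingHom.map_det, hCπ, ← Matrix.diagonal_natCast, Matrix.det_diagonal, Finset.prod_const,
        Finset.card_univ]
    rw [h0, map_zero] at this
    exact not_isUnit_zero (this ▸ hM'u.pow _)
  have hB1 : B - 1 = 0 := by
    have : C.det • (B - 1) = 0 := by
      rw [← Matrix.one_mul (B - 1), ← Matrix.smul_mul, ← Matrix.adjugate_mul, Matrix.mul_assoc,
        hgeom, Matrix.mul_zero]
    exact (smul_eq_zero.1 this).resolve_left hdet
  refine ⟨p ^ (a + c), ?_⟩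
  have : N = A - 1 := by rw [hAdef, add_sub_cancel_left]
  rw [this, sub_pow_char_pow_of_commute _ _ (Commute.one_right _), one_pow, ← hB, hB1]

end UnipotentConjugation

section KrullDimension

theorem ringKrullDim_le_card_of_mem_adjoin {k A K : Type*} [Field k] [CommRing A] [Nontrivial A]
    [Algebra k A] [Algebra.FiniteType k A] [Field K] [Algebra k K] (f : A →ₐ[k] K)
    (hf : Function.Injective f) (s : Finset K)
    (hs : ∀ a, f a ∈ IntermediateField.adjoin k (s : Set K)) : ringKrullDim A ≤ s.card := by
  obtain ⟨r, g, hg, hgInt⟩ := exists_integral_inj_algHom_of_fg k A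
  have hdim : ringKrullDim A ≤ ringKrullDim (MvPolynomial (Fin r) k) := by
    let := g.toRingHom.toAlgebra
    have : Algebra.IsIntegral (MvPolynomial (Fin r) k) A := ⟨hgInt⟩
    refine Order.krullDim_le_of_strictMono
      (PrimeSpectrum.comap (algebraMap (MvPolynomial (Fin r) k) A)) fun P Q h => ?_
    exact Ideal.IsIntegral.comap_lt_comap (I := P.asIdeal) (J := Q.asIdeal) h
  refine hdim.trans ?_
  rw [MvPolynomial.ringKrullDim_of_isNoetherianRing, ringKrullDim_eq_zero_of_field, zero_add,
    Nat.card_eq_fintype_card, Fintype.card_fin]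
  let F := IntermediateField.adjoin k (s : Set K)
  let f' : A →ₐ[k] F := f.codRestrict F.toSubalgebra hs
  have hf' : Function.Injective f' := fun a b hab => hf (congrArg Subtype.val hab)
  have hind : AlgebraicIndependent k fun i => f' (g (MvPolynomial.X i)) := by
    rw [algebraicIndependent_iff_injective_aeval]
    convert hf'.comp hg
    rw [← AlgHom.coe_comp]
    congr 1
    ext i
    simp
  have h1 := hind.lift_cardinalMk_le_trdeg
  let s' : Set F := Subtype.val ⁻¹' (s : Set K)
  have himage : Subtype.val '' s' = (s : Set K) := by
    refine (Subtype.image_preimage_coe (F : Set K) (s : Set K)).trans ?_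
    exact Set.inter_eq_right.2 (IntermediateField.subset_adjoin k _)
  have hmem (y : K) (hy : y ∈ Algebra.adjoin k (s : Set K)) :
      ∃ z : Algebra.adjoin k s', ((z : F) : K) = y := by
    rw [← himage] at hy
    have := (AlgHom.map_adjoin F.val s').symm.le hy
    obtain ⟨z, hz, rfl⟩ := this
    exact ⟨⟨z, hz⟩, rfl⟩
  have : Algebra.IsAlgebraic (Algebra.adjoin k s') F := by
    refine ⟨fun x => ?_⟩
    obtain ⟨a, ha, b, hb, hab⟩ := IntermediateField.mem_adjoin_iff_div.1 x.2
    obtain ⟨a', rfl⟩ := hmem a ha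
    obtain ⟨b', rfl⟩ := hmem b hb
    have hx : x = algebraMap (Algebra.adjoin k s') F a' * (algebraMap _ F b')⁻¹ := by
      rw [← div_eq_mul_inv]
      exact Subtype.ext hab
    rw [hx]
    exact (isAlgebraic_algebraMap a').mul (isAlgebraic_algebraMap b').inv
  have h2 := Algebra.IsAlgebraic.trdeg_le_cardinalMk k s'
  have h3 : Cardinal.mk s' = s.card := by
    rw [← Cardinal.mk_image_eq Subtype.val_injective, himage]
    exact Cardinal.mk_coe_finset
  rw [h3] at h2
  have h4 := h1.trans (Cardinal.lift_le.2 h2)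
  simp only [Cardinal.mk_fintype, Fintype.card_fin, Cardinal.lift_natCast, Nat.cast_le] at h4
  exact_mod_cast h4

theorem Ideal.exists_finset_of_ringKrullDim_quotient_le {R : Type*} [CommRing R]
    [IsNoetherianRing R] {J m : Ideal R} [m.IsPrime] (hJm : J ≤ m) {b : ℕ}
    (h : ∀ P : Ideal R, P.IsPrime → J ≤ P → P ≤ m → ringKrullDim (R ⧸ P) ≤ b) :
    ∃ s : Finset R, s.card ≤ b ∧ (∀ x ∈ s, x ∈ m) ∧
      ∀ Q : Ideal R, Q.IsPrime → J ≤ Q → (∀ x ∈ s, x ∈ Q) → Q ≤ m → Q = m := by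
  classical
  let m' := m.map (Ideal.Quotient.mk J)
  have : m'.IsPrime := Ideal.isPrime_map_quotientMk_of_isPrime hJm
  have hcm : m'.comap (Ideal.Quotient.mk J) = m := by
    rw [Ideal.comap_map_of_surjective _ Ideal.Quotient.mk_surjective, ← RingHom.ker_eq_comap_bot,
      Ideal.mk_ker, sup_eq_left.2 hJm]
  obtain ⟨l, hl, hlen⟩ := m'.exists_ltSeries_length_eq_height
  let P := l.head.asIdeal.comap (Ideal.Quotient.mk J)
  have hker (x : PrimeSpectrum (R ⧸ J)) : J ≤ x.asIdeal.comap (Ideal.Quotient.mk J) := by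
    rw [← Ideal.map_le_iff_le_comap, Ideal.map_quotient_self]
    exact bot_le
  have hheight : m'.height ≤ b := by
    have hP : ringKrullDim (R ⧸ P) ≤ b := by
      refine h P inferInstance (hker _) ?_
      rw [← hcm]
      refine Ideal.comap_mono ?_
      have : l.head ≤ l.last := l.head_le_last
      rw [hl] at this
      exact this
    let l' : LTSeries (PrimeSpectrum.zeroLocus (R := R) P) :=
      { length := l.length
        toFun i := ⟨PrimeSpectrum.comap (Ideal.Quotient.mk J) (l i), by
          exact Ideal.comap_mono (l.head_le i)⟩
        step i := by
          have : l i.castSucc < l i.succ := l.step i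
          refine lt_of_le_of_ne (Ideal.comap_mono this.le) fun heq => this.ne ?_
          exact PrimeSpectrum.comap_injective_of_surjective _ Ideal.Quotient.mk_surjective
            (PrimeSpectrum.ext heq) }
    have := Order.LTSeries.length_le_krullDim l'
    rw [← ringKrullDim_quotient] at this
    rw [← hlen]
    exact_mod_cast this.trans hP
  obtain ⟨s, hs, hcard⟩ := m'.exists_finset_card_eq_height_of_isNoetherianRing
  have hsm (x : R ⧸ J) (hx : x ∈ s) : x ∈ m' := hs.1.2 (Ideal.subset_span hx)
  have hmk (x : R ⧸ J) : Ideal.Quotient.mk J x.out = x := Ideal.Quotient.mk_out x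
  refine ⟨s.image Quotient.out, ?_, ?_, ?_⟩
  · refine Finset.card_image_le.trans ?_
    rw [← hcard] at hheight
    exact_mod_cast hheight
  · simp only [Finset.mem_image]
    rintro _ ⟨x, hx, rfl⟩
    rw [← hcm, Ideal.mem_comap, hmk]
    exact hsm x hx
  · intro Q hQ hJQ hsQ hQm
    have hQ' : (Q.map (Ideal.Quotient.mk J)).IsPrime :=
      Ideal.isPrime_map_quotientMk_of_isPrime hJQ
    refine le_antisymm hQm ?_
    have hle : m' ≤ Q.map (Ideal.Quotient.mk J) := by
      refine hs.2 ⟨hQ', Ideal.span_le.2 fun x hx => ?_⟩ (Ideal.map_mono hQm)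
      rw [← hmk x]
      exact Ideal.mem_map_of_mem _ (hsQ _ (Finset.mem_image_of_mem _ hx))
    have := Ideal.comap_mono (f := Ideal.Quotient.mk J) hle
    rwa [hcm, Ideal.comap_map_of_surjective _ Ideal.Quotient.mk_surjective,
      ← RingHom.ker_eq_comap_bot, Ideal.mk_ker, sup_eq_left.2 hJQ] at this

end KrullDimension

section UnipotentConjugationScheme

/-- The ideal generated by the entries of the matrix
`(1 + Y) * (1 + X) - (1 + X) ^ (q + 1) * (1 + Y)`, where `X` and `Y` are square matrices of independent variables. -/
def unipotentConjugationIdeal (k ι : Type*) [CommRing k] [Fintype ι] [DecidableEq ι] (q : ℕ) :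
    Ideal (MvPolynomial (Fin 2 × ι × ι) k) :=
  Ideal.span (Set.range fun ij : ι × ι =>
    ((1 + Matrix.of fun i j => MvPolynomial.X (1, i, j)) *
          (1 + Matrix.of fun i j => MvPolynomial.X (0, i, j)) -
        (1 + Matrix.of fun i j => MvPolynomial.X (0, i, j)) ^ (q + 1) *
          (1 + Matrix.of fun i j => MvPolynomial.X (1, i, j)) :
      Matrix ι ι (MvPolynomial (Fin 2 × ι × ι) k)) ij.1 ij.2)

theorem Matrix.one_add_pow_prime_pow_succ {ι R : Type*} [Fintype ι] [DecidableEq ι] [Nonempty ι]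
    [CommRing R] {p s : ℕ} [Fact p.Prime] [CharP R p] (hs : p ^ s ≠ 0) (N : Matrix ι ι R) :
    (1 + N) ^ (p ^ s + 1) = 1 + N * (1 + N ^ (p ^ s - 1) + N ^ p ^ s) := by
  have hN : N * N ^ (p ^ s - 1) = N ^ p ^ s := mul_pow_sub_one hs N
  have h : N * (1 + N ^ (p ^ s - 1) + N ^ p ^ s) = N + N ^ p ^ s + N ^ p ^ s * N := by
    rw [mul_add, mul_add, mul_one, hN, ← pow_succ, ← pow_succ']
  rw [h, pow_succ, add_pow_char_pow_of_commute p s (Commute.one_left N), one_pow, mul_add, mul_one,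
    add_mul, one_mul]
  abel

theorem ringKrullDim_quotient_le_of_unipotentConjugationIdeal_le {k ι : Type u} [Field k]
    [Fintype ι] [DecidableEq ι] [Nonempty ι] {p s : ℕ} [Fact p.Prime] [CharP k p]
    (hs : 1 < p ^ s) {P : Ideal (MvPolynomial (Fin 2 × ι × ι) k)} [P.IsPrime]
    (hJ : unipotentConjugationIdeal k ι (p ^ s) ≤ P)
    (hP : P ≤ RingHom.ker (MvPolynomial.constantCoeff (σ := Fin 2 × ι × ι) (R := k))) :
    ringKrullDim (MvPolynomial (Fin 2 × ι × ι) k ⧸ P) ≤ (Fintype.card ι ^ 2 : ℕ) := by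
  let T := MvPolynomial (Fin 2 × ι × ι) k
  let D := T ⧸ P
  let mk : T →+* D := Ideal.Quotient.mk P
  let K := FractionRing D
  let π : D →+* k := Ideal.Quotient.lift P MvPolynomial.constantCoeff fun a ha => hP ha
  let N : Matrix ι ι D := Matrix.of fun i j => mk (MvPolynomial.X (0, i, j))
  let g : Matrix ι ι D := 1 + Matrix.of fun i j => mk (MvPolynomial.X (1, i, j))
  have : CharP D p := charP_of_injective_algebraMap (algebraMap k D).injective p
  have hπ (x : T) : π (mk x) = MvPolynomial.constantCoeff x := rfl
  have hg_apply (i j : ι) : g i j = (if i = j then 1 else 0) + mk (MvPolynomial.X (1, i, j)) := by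
    rw [← Matrix.one_apply]
    rfl
  have hN : N.map π = 0 := by
    ext i j
    exact (hπ _).trans (MvPolynomial.constantCoeff_X _ _)
  have hg : g.map π = 1 := by
    ext i j
    rw [Matrix.map_apply, hg_apply, map_add, hπ, MvPolynomial.constantCoeff_X, add_zero,
      Matrix.one_apply]
    split_ifs
    · exact map_one π
    · exact map_zero π
  have hrel : g * (1 + N) = (1 + N) ^ (p ^ s + 1) * g := by
    have h0 : (1 + Matrix.of fun i j => MvPolynomial.X (0, i, j) : Matrix ι ι T).map mk =
        1 + N := by
      ext i j
      simp [N, Matrix.one_apply, apply_ite]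
    have h1 : (1 + Matrix.of fun i j => MvPolynomial.X (1, i, j) : Matrix ι ι T).map mk = g := by
      ext i j
      simp [g, Matrix.one_apply, apply_ite]
    rw [← h0, ← h1, ← sub_eq_zero]
    simp only [← RingHom.mapMatrix_apply, ← map_mul, ← map_pow, ← map_sub]
    ext i j
    exact Ideal.Quotient.eq_zero_iff_mem.2 (hJ (Ideal.subset_span ⟨(i, j), rfl⟩))
  have hnil : IsNilpotent N := Matrix.isNilpotent_of_conj_eq_pow π hN hg hrel
  let φ : Polynomial k := 1 + Polynomial.X ^ (p ^ s - 1) + Polynomial.X ^ p ^ s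
  have hφ : φ.coeff 0 ≠ 0 := by
    have h1 : ¬ 0 = p ^ s - 1 := by omega
    have h2 : ¬ 0 = p ^ s := by omega
    simp only [φ, Polynomial.coeff_add, Polynomial.coeff_one_zero, Polynomial.coeff_X_pow,
      if_neg h1, if_neg h2, add_zero]
    exact one_ne_zero
  have hrel' : g * N = N * Polynomial.aeval N φ * g := by
    rw [Matrix.one_add_pow_prime_pow_succ (by omega)] at hrel
    have hcancel {a b u : Matrix ι ι D} (h : a * (1 + b) = (1 + b * u) * a) :
        a * b = b * u * a := by
      rw [mul_add, mul_one, add_mul, one_mul] at h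
      exact add_left_cancel h
    simpa only [φ, map_add, map_one, map_pow, Polynomial.aeval_X] using hcancel hrel
  let e : D →ₐ[k] K := Algebra.algHom k D K
  have hmap := congrArg e.mapMatrix hrel'
  rw [map_mul, map_mul, map_mul, ← Polynomial.aeval_algHom_apply] at hmap
  obtain ⟨t, ht, htN, htg⟩ := Matrix.exists_finset_card_le_sq hφ _ _ (hnil.map e.mapMatrix) hmap
  have he : Function.Injective e := IsFractionRing.injective D K
  refine (ringKrullDim_le_card_of_mem_adjoin e he t fun a => ?_).trans (by exact_mod_cast ht)
  obtain ⟨f, rfl⟩ := Ideal.Quotient.mk_surjective a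
  induction f using MvPolynomial.induction_on with
  | C a => exact (IntermediateField.adjoin k (t : Set K)).algebraMap_mem a
  | add f g hf hg =>
    rw [map_add, map_add]
    exact add_mem hf hg
  | mul_X f x hf =>
    rw [map_mul, map_mul]
    refine mul_mem hf ?_
    obtain ⟨b, i, j⟩ := x
    match b with
    | 0 => exact htN i j
    | 1 =>
      have h1 := htg i j
      rw [AlgHom.mapMatrix_apply, Matrix.map_apply, hg_apply, map_add] at h1
      refine (add_mem_cancel_left ?_).1 h1
      split_ifs
      · exact (map_one e).symm ▸ one_mem _
      · exact (map_zero e).symm ▸ zero_mem _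

theorem exists_finset_of_unipotentConjugationIdeal_le (k ι : Type u) [Field k] [Fintype ι]
    [DecidableEq ι] [Nonempty ι] {p s : ℕ} [Fact p.Prime] [CharP k p] (hs : 1 < p ^ s) :
    ∃ t : Finset (MvPolynomial (Fin 2 × ι × ι) k), t.card ≤ Fintype.card ι ^ 2 ∧
      (∀ x ∈ t, MvPolynomial.constantCoeff x = 0) ∧
      ∀ Q : Ideal (MvPolynomial (Fin 2 × ι × ι) k), Q.IsPrime →
        unipotentConjugationIdeal k ι (p ^ s) ≤ Q → (∀ x ∈ t, x ∈ Q) →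
        Q ≤ RingHom.ker MvPolynomial.constantCoeff → ∀ x, MvPolynomial.X x ∈ Q := by
  have hprime : (RingHom.ker
      (MvPolynomial.constantCoeff (σ := Fin 2 × ι × ι) (R := k))).IsPrime := RingHom.ker_isPrime _
  have hle : unipotentConjugationIdeal k ι (p ^ s) ≤
      RingHom.ker (MvPolynomial.constantCoeff (σ := Fin 2 × ι × ι) (R := k)) := by
    refine Ideal.span_le.2 ?_
    rintro _ ⟨⟨i, j⟩, rfl⟩
    let c := MvPolynomial.constantCoeff (σ := Fin 2 × ι × ι) (R := k)
    have h (b : Fin 2) : c.mapMatrix (1 + Matrix.of fun i j => MvPolynomial.X (b, i, j)) =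
        (1 : Matrix ι ι k) := by
      ext i j
      simp [c, Matrix.one_apply, apply_ite]
    have hzero : c.mapMatrix ((1 + Matrix.of fun i j => MvPolynomial.X (1, i, j)) *
          (1 + Matrix.of fun i j => MvPolynomial.X (0, i, j)) -
        (1 + Matrix.of fun i j => MvPolynomial.X (0, i, j)) ^ (p ^ s + 1) *
          (1 + Matrix.of fun i j => MvPolynomial.X (1, i, j))) = (0 : Matrix ι ι k) := by
      rw [map_sub, map_mul, map_mul, map_pow, h, h]
      simp
    exact congrFun (congrFun hzero i) j
  obtain ⟨t, ht, htm, htQ⟩ := Ideal.exists_finset_of_ringKrullDim_quotient_le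
    (J := unipotentConjugationIdeal k ι (p ^ s))
    (m := RingHom.ker (MvPolynomial.constantCoeff (σ := Fin 2 × ι × ι) (R := k))) hle
    fun P _ hJ hP => ringKrullDim_quotient_le_of_unipotentConjugationIdeal_le hs hJ hP
  refine ⟨t, ht, fun x hx => htm x hx, fun Q hQ hJ htQ' hQm x => ?_⟩
  rw [htQ Q hQ hJ htQ' hQm]
  exact MvPolynomial.constantCoeff_X _ x

end UnipotentConjugationScheme

section PadicIntegralClosure

theorem natCast_ne_zero_integralClosure_padicInt (p : ℕ) [Fact p.Prime] (L : Type*)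
    [Field L] [Algebra ℚ_[p] L] [Algebra ℤ_[p] L] :
    (p : integralClosure ℤ_[p] L) ≠ 0 := by
  intro h
  have h1 : (p : L) = 0 := congrArg Subtype.val h
  rw [← map_natCast (algebraMap ℚ_[p] L), map_eq_zero] at h1
  exact (Fact.out : p.Prime).ne_zero (by exact_mod_cast h1)

theorem eq_maximalIdeal_of_natCast_mem_integralClosure_padicInt (p : ℕ) [Fact p.Prime] (L : Type*)
    [Field L] [Algebra ℤ_[p] L] [IsLocalRing (integralClosure ℤ_[p] L)]
    {Q : Ideal (integralClosure ℤ_[p] L)} [Q.IsPrime] (hQ : (p : integralClosure ℤ_[p] L) ∈ Q) :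
    Q = IsLocalRing.maximalIdeal _ := by
  refine IsLocalRing.eq_maximalIdeal ?_
  refine Ideal.IsIntegral.isMaximal_of_isMaximal_comap (R := ℤ_[p]) Q ?_
  have hle : IsLocalRing.maximalIdeal ℤ_[p] ≤
      Q.comap (algebraMap ℤ_[p] (integralClosure ℤ_[p] L)) := by
    rw [PadicInt.maximalIdeal_eq_span_p, Ideal.span_singleton_le_iff_mem, Ideal.mem_comap,
      map_natCast]
    exact hQ
  rw [← (IsLocalRing.maximalIdeal.isMaximal ℤ_[p]).eq_of_le
    (Ideal.IsPrime.ne_top inferInstance) hle]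
  infer_instance

variable (p : ℕ) [Fact p.Prime] (L : Type*) [Field L] [Algebra ℚ_[p] L] [FiniteDimensional ℚ_[p] L]
  [Algebra ℤ_[p] L] [IsScalarTower ℤ_[p] ℚ_[p] L]

theorem isIntegral_padicInt_iff {x : L} :
    IsIntegral ℤ_[p] x ↔ spectralMulAlgNorm ℚ_[p] L x ≤ 1 := by
  have hx : IsIntegral ℚ_[p] x := Algebra.IsIntegral.isIntegral x
  rw [spectralMulAlgNorm_def, spectralNorm, spectralValue_le_one_iff (minpoly.monic hx)]
  refine ⟨fun h n => ?_, fun h => ?_⟩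
  · rw [minpoly.isIntegrallyClosed_eq_field_fractions' ℚ_[p] h, Polynomial.coeff_map]
    exact PadicInt.norm_le_one _
  · obtain ⟨P, hP⟩ : minpoly ℚ_[p] x ∈ Polynomial.lifts (algebraMap ℤ_[p] ℚ_[p]) := by
      rw [Polynomial.lifts_iff_coeff_lifts]
      exact fun n => ⟨⟨_, h n⟩, rfl⟩
    have hP' : P.map (algebraMap ℤ_[p] ℚ_[p]) = minpoly ℚ_[p] x := hP
    refine ⟨P, ?_, ?_⟩
    · refine Polynomial.monic_of_injective (IsFractionRing.injective ℤ_[p] ℚ_[p]) ?_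
      rw [hP']
      exact minpoly.monic hx
    · have := minpoly.aeval ℚ_[p] x
      rw [← hP', Polynomial.aeval_map_algebraMap] at this
      exact this

theorem isUnit_integralClosure_padicInt {a : integralClosure ℤ_[p] L}
    (ha : 1 ≤ spectralMulAlgNorm ℚ_[p] L a) : IsUnit a := by
  have ha0 : (a : L) ≠ 0 := by
    intro h
    rw [h, map_zero] at ha
    exact absurd ha (by norm_num)
  have hmul : spectralMulAlgNorm ℚ_[p] L a * spectralMulAlgNorm ℚ_[p] L (a : L)⁻¹ = 1 := by
    rw [← map_mul, mul_inv_cancel₀ ha0, map_one]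
  have hinv : IsIntegral ℤ_[p] (a : L)⁻¹ := by
    rw [isIntegral_padicInt_iff]
    nlinarith [apply_nonneg (spectralMulAlgNorm ℚ_[p] L) (a : L)⁻¹]
  exact IsUnit.of_mul_eq_one ⟨_, hinv⟩ (Subtype.ext (mul_inv_cancel₀ ha0))

theorem isLocalRing_integralClosure_padicInt : IsLocalRing (integralClosure ℤ_[p] L) := by
  refine IsLocalRing.of_isUnit_or_isUnit_one_sub_self fun a => ?_
  by_contra! h
  have h1 := mt (isUnit_integralClosure_padicInt p L) h.1
  have h2 := mt (isUnit_integralClosure_padicInt p L) h.2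
  have h3 := isNonarchimedean_spectralNorm (K := ℚ_[p]) (L := L) (a : L) (1 - a : L)
  rw [add_sub_cancel, spectralNorm_one, le_max_iff] at h3
  exact h3.elim h1 h2

theorem isNoetherianRing_integralClosure_padicInt : IsNoetherianRing (integralClosure ℤ_[p] L) :=
  IsIntegralClosure.isNoetherianRing ℤ_[p] ℚ_[p] L (integralClosure ℤ_[p] L)

theorem not_isUnit_natCast_integralClosure_padicInt :
    ¬ IsUnit (p : integralClosure ℤ_[p] L) := by
  intro h
  obtain ⟨b, hb⟩ := h.exists_right_inv
  have hp : spectralMulAlgNorm ℚ_[p] L (p : L) = (p : ℝ)⁻¹ := by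
    rw [← map_natCast (algebraMap ℚ_[p] L), spectralMulAlgNorm_def, spectralNorm_extends,
      Padic.norm_p]
  have hb' : (p : L) * b = 1 := congrArg Subtype.val hb
  have hmul := congrArg (spectralMulAlgNorm ℚ_[p] L) hb'
  rw [map_mul, hp, map_one] at hmul
  have h1 := (isIntegral_padicInt_iff p L).1 b.2
  have h2 : (1 : ℝ) < p := by exact_mod_cast (Fact.out : p.Prime).one_lt
  have h3 : (p : ℝ)⁻¹ < 1 := inv_lt_one_of_one_lt₀ h2
  have h4 : 0 < (p : ℝ)⁻¹ := by positivity
  nlinarith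

end PadicIntegralClosure

section PowerSeriesRing

theorem mem_entriesList {R : Type*} [CommRing R] {n : ℕ} {M : Matrix (Fin n) (Fin n) R} {x : R} :
    x ∈ entriesList M ↔ ∃ i j, M i j = x := by
  simp [entriesList]

theorem length_entriesList {R : Type*} [CommRing R] {n : ℕ} (M : Matrix (Fin n) (Fin n) R) :
    (entriesList M).length = n * n := by
  simp [entriesList, List.length_flatMap]

theorem MvPowerSeries.mem_of_forall_coeff_eq_zero {σ A : Type*} [CommRing A]
    {I : Ideal (MvPowerSeries σ A)} (s : Finset σ) (hI : ∀ x ∈ s, MvPowerSeries.X x ∈ I)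
    {f : MvPowerSeries σ A}
    (hf : ∀ d : σ →₀ ℕ, (∀ x ∈ s, d x = 0) → MvPowerSeries.coeff d f = 0) : f ∈ I := by
  classical
  induction s using Finset.induction_on generalizing f with
  | empty =>
    have : f = 0 := MvPowerSeries.ext fun d => hf d (by simp)
    exact this ▸ I.zero_mem
  | insert a s ha ih =>
    let f₀ : MvPowerSeries σ A := fun d => if d a = 0 then MvPowerSeries.coeff d f else 0
    have hf₀ (d : σ →₀ ℕ) :
        MvPowerSeries.coeff d f₀ = if d a = 0 then MvPowerSeries.coeff d f else 0 := rfl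
    have h₀ : f₀ ∈ I := by
      refine ih (fun x hx => hI x (Finset.mem_insert_of_mem hx)) fun d hd => ?_
      rw [hf₀]
      split_ifs with hda
      · exact hf d (by simpa [hda] using hd)
      · rfl
    have hdvd : MvPowerSeries.X a ∣ f - f₀ := by
      refine MvPowerSeries.X_dvd_iff.2 fun d hd => ?_
      rw [map_sub, hf₀, if_pos hd, sub_self]
    have := I.add_mem (I.mem_of_dvd hdvd (hI a (Finset.mem_insert_self a s))) h₀
    rwa [sub_add_cancel] at this

theorem MvPowerSeries.mem_of_constantCoeff_eq_zero {σ A : Type*} [Finite σ] [CommRing A]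
    {I : Ideal (MvPowerSeries σ A)} (hI : ∀ x, MvPowerSeries.X x ∈ I) {f : MvPowerSeries σ A}
    (hf : MvPowerSeries.constantCoeff f = 0) : f ∈ I := by
  have := Fintype.ofFinite σ
  refine MvPowerSeries.mem_of_forall_coeff_eq_zero Finset.univ (fun x _ => hI x) fun d hd => ?_
  have : d = 0 := Finsupp.ext fun x => hd x (Finset.mem_univ x)
  rw [this]
  exact hf

theorem MvPowerSeries.mem_maximalIdeal_iff {σ A : Type*} [CommRing A] [IsLocalRing A]
    {f : MvPowerSeries σ A} : f ∈ IsLocalRing.maximalIdeal (MvPowerSeries σ A) ↔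
      MvPowerSeries.constantCoeff f ∈ IsLocalRing.maximalIdeal A := by
  rw [IsLocalRing.mem_maximalIdeal, IsLocalRing.mem_maximalIdeal, mem_nonunits_iff,
    mem_nonunits_iff, MvPowerSeries.isUnit_iff_constantCoeff]

theorem MvPowerSeries.eq_maximalIdeal_of_forall_X_mem {σ A : Type*} [Finite σ] [CommRing A]
    [IsLocalRing A] {Q : Ideal (MvPowerSeries σ A)} [Q.IsPrime]
    (hC : ∀ a ∈ IsLocalRing.maximalIdeal A, MvPowerSeries.C a ∈ Q)
    (hX : ∀ x, MvPowerSeries.X x ∈ Q) : Q = IsLocalRing.maximalIdeal (MvPowerSeries σ A) := by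
  refine le_antisymm (IsLocalRing.le_maximalIdeal (Ideal.IsPrime.ne_top inferInstance))
    fun f hf => ?_
  have h1 := hC _ (MvPowerSeries.mem_maximalIdeal_iff.1 hf)
  have h2 : f - MvPowerSeries.C (MvPowerSeries.constantCoeff f) ∈ Q :=
    MvPowerSeries.mem_of_constantCoeff_eq_zero hX (by simp)
  have := Q.add_mem h2 h1
  rwa [sub_add_cancel] at this

/-- The substitution of power series variables, indexed by `e`, into a polynomial. -/
def MvPolynomial.evalPowerSeriesX {σ τ : Type*} (A : Type*) [CommRing A] (e : τ → σ) :
    MvPolynomial τ A →+* MvPowerSeries σ A :=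
  MvPolynomial.eval₂Hom MvPowerSeries.C fun x => MvPowerSeries.X (e x)

theorem MvPolynomial.evalPowerSeriesX_X {σ τ A : Type*} [CommRing A] (e : τ → σ) (x : τ) :
    MvPolynomial.evalPowerSeriesX A e (MvPolynomial.X x) = MvPowerSeries.X (e x) :=
  MvPolynomial.eval₂Hom_X' _ _ _

theorem MvPolynomial.constantCoeff_evalPowerSeriesX {σ τ A : Type*} [CommRing A] (e : τ → σ)
    (f : MvPolynomial τ A) : MvPowerSeries.constantCoeff (MvPolynomial.evalPowerSeriesX A e f) =
      MvPolynomial.constantCoeff f := by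
  have h : (MvPowerSeries.constantCoeff (σ := σ) (R := A)).comp
      (MvPolynomial.evalPowerSeriesX A e) = MvPolynomial.constantCoeff := by
    ext <;> simp [MvPolynomial.evalPowerSeriesX]
  exact RingHom.congr_fun h f

open IsLocalRing in
theorem MvPowerSeries.exists_ideal_residueField {σ τ A : Type*} [CommRing A] [IsLocalRing A]
    (e : τ → σ) {Q : Ideal (MvPowerSeries σ A)} [Q.IsPrime]
    (hC : ∀ a ∈ maximalIdeal A, MvPowerSeries.C a ∈ Q) :
    ∃ Q' : Ideal (MvPolynomial τ (ResidueField A)), Q'.IsPrime ∧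
      (∀ f : MvPolynomial τ A,
        MvPolynomial.map (residue A) f ∈ Q' ↔ MvPolynomial.evalPowerSeriesX A e f ∈ Q) ∧
      Q' ≤ RingHom.ker MvPolynomial.constantCoeff := by
  let κ : ResidueField A →+* MvPowerSeries σ A ⧸ Q :=
    Ideal.Quotient.lift (maximalIdeal A) ((Ideal.Quotient.mk Q).comp MvPowerSeries.C)
      fun a ha => Ideal.Quotient.eq_zero_iff_mem.2 (hC a ha)
  let ψ : MvPolynomial τ (ResidueField A) →+* MvPowerSeries σ A ⧸ Q :=
    MvPolynomial.eval₂Hom κ fun x => Ideal.Quotient.mk Q (MvPowerSeries.X (e x))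
  have hψ (f : MvPolynomial τ A) : ψ (MvPolynomial.map (residue A) f) =
      Ideal.Quotient.mk Q (MvPolynomial.evalPowerSeriesX A e f) := by
    have h : ψ.comp (MvPolynomial.map (residue A)) =
        (Ideal.Quotient.mk Q).comp (MvPolynomial.evalPowerSeriesX A e) := by
      refine MvPolynomial.ringHom_ext (fun a => ?_) fun x => ?_
      · simp only [RingHom.comp_apply, MvPolynomial.map_C, MvPolynomial.evalPowerSeriesX,
          MvPolynomial.eval₂Hom_C, ψ]
        rfl
      · simp only [RingHom.comp_apply, MvPolynomial.map_X, MvPolynomial.evalPowerSeriesX,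
          MvPolynomial.eval₂Hom_X', ψ]
    exact RingHom.congr_fun h f
  have hiff (f : MvPolynomial τ A) : MvPolynomial.map (residue A) f ∈ RingHom.ker ψ ↔
      MvPolynomial.evalPowerSeriesX A e f ∈ Q := by
    rw [RingHom.mem_ker, hψ, Ideal.Quotient.eq_zero_iff_mem]
  refine ⟨RingHom.ker ψ, RingHom.ker_isPrime ψ, hiff, fun f hf => ?_⟩
  obtain ⟨f, rfl⟩ := MvPolynomial.map_surjective _ residue_surjective f
  have := le_maximalIdeal (Ideal.IsPrime.ne_top inferInstance) ((hiff f).1 hf)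
  rw [MvPowerSeries.mem_maximalIdeal_iff, MvPolynomial.constantCoeff_evalPowerSeriesX] at this
  rw [RingHom.mem_ker, MvPolynomial.constantCoeff_map]
  exact (residue_eq_zero_iff _).2 this

theorem Matrix.mapMatrix_unipotentConjugation {ι R R' : Type*} [Fintype ι] [DecidableEq ι]
    [CommRing R] [CommRing R'] (f : R →+* R') (q : ℕ) (X Y : Matrix ι ι R) :
    f.mapMatrix ((1 + Y) * (1 + X) - (1 + X) ^ (q + 1) * (1 + Y)) =
      (1 + f.mapMatrix Y) * (1 + f.mapMatrix X) -
        (1 + f.mapMatrix X) ^ (q + 1) * (1 + f.mapMatrix Y) := by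
  simp only [map_sub, map_mul, map_pow, map_add, map_one]

open IsLocalRing in
theorem MvPowerSeries.isRegular_unipotentConjugation {A : Type} [CommRing A] [IsDomain A]
    [IsLocalRing A] [IsNoetherianRing A] {p s m n : ℕ} [Fact p.Prime] (hs : 1 < p ^ s)
    (hn : 1 ≤ n) (hp0 : (p : A) ≠ 0) (hpu : ¬ IsUnit (p : A))
    (hpm : ∀ Q : Ideal A, Q.IsPrime → (p : A) ∈ Q → Q = maximalIdeal A) :
    RingTheory.Sequence.IsRegular (MvPowerSeries (Fin (2 * m + 2) × Fin n × Fin n) A)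
      (entriesList
          (Xt (A := A) (2 * m + 2) n ⟨1, by omega⟩ * Xt (A := A) (2 * m + 2) n ⟨0, by omega⟩ -
            (Xt (A := A) (2 * m + 2) n ⟨0, by omega⟩) ^ (p ^ s + 1) *
              Xt (A := A) (2 * m + 2) n ⟨1, by omega⟩) ++
        ((List.finRange (2 * m)).flatMap fun k =>
          (List.finRange n).flatMap fun i =>
            (List.finRange n).map fun j =>
              (MvPowerSeries.X (k.addNat 2, i, j) :
                MvPowerSeries (Fin (2 * m + 2) × Fin n × Fin n) A)) ++
        [(p : MvPowerSeries (Fin (2 * m + 2) × Fin n × Fin n) A)]) := by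
  set S := MvPowerSeries (Fin (2 * m + 2) × Fin n × Fin n) A with hS
  set M : Matrix (Fin n) (Fin n) S :=
    Xt (A := A) (2 * m + 2) n ⟨1, by omega⟩ * Xt (A := A) (2 * m + 2) n ⟨0, by omega⟩ -
      (Xt (A := A) (2 * m + 2) n ⟨0, by omega⟩) ^ (p ^ s + 1) *
        Xt (A := A) (2 * m + 2) n ⟨1, by omega⟩ with hM
  set xs : List S := (List.finRange (2 * m)).flatMap fun k => (List.finRange n).flatMap fun i =>
    (List.finRange n).map fun j => (MvPowerSeries.X (k.addNat 2, i, j) : S) with hxs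
  have : Nonempty (Fin n) := ⟨⟨0, hn⟩⟩
  have hpA : (p : A) ∈ maximalIdeal A := hpu
  have hchar : CharP (ResidueField A) p := by
    have h0 : (p : ResidueField A) = 0 := by
      rw [← map_natCast (residue A), residue_eq_zero_iff]
      exact hpA
    exact CharP.ringChar_of_prime_eq_zero Fact.out h0 ▸ ringChar.charP (ResidueField A)
  let e : Fin 2 × Fin n × Fin n → Fin (2 * m + 2) × Fin n × Fin n :=
    fun x => (Fin.castLE (by omega) x.1, x.2)
  let Λ := MvPolynomial.evalPowerSeriesX A e
  let W : Matrix (Fin n) (Fin n) (MvPolynomial (Fin 2 × Fin n × Fin n) A) :=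
    (1 + Matrix.of fun i j => MvPolynomial.X (1, i, j)) *
        (1 + Matrix.of fun i j => MvPolynomial.X (0, i, j)) -
      (1 + Matrix.of fun i j => MvPolynomial.X (0, i, j)) ^ (p ^ s + 1) *
        (1 + Matrix.of fun i j => MvPolynomial.X (1, i, j))
  have hΛ (b : Fin 2) : Λ.mapMatrix (Matrix.of fun i j => MvPolynomial.X (b, i, j)) =
      varMatrix (2 * m + 2) n (Fin.castLE (by omega) b) :=
    Matrix.ext fun i j => MvPolynomial.evalPowerSeriesX_X e (b, i, j)
  have hΛW : Λ.mapMatrix W = M := by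
    refine (Matrix.mapMatrix_unipotentConjugation Λ (p ^ s) _ _).trans ?_
    rw [hΛ, hΛ]
    rfl
  have hρ (b : Fin 2) : (MvPolynomial.map (residue A)).mapMatrix
      (Matrix.of fun i j : Fin n => MvPolynomial.X (b, i, j)) =
        Matrix.of fun i j => MvPolynomial.X (b, i, j) := by
    exact Matrix.ext fun i j => MvPolynomial.map_X _ _
  obtain ⟨t, htcard, ht0, ht⟩ :=
    exists_finset_of_unipotentConjugationIdeal_le (ResidueField A) (Fin n) hs
  rw [Fintype.card_fin] at htcard
  choose lift hlift using MvPolynomial.map_surjective (σ := Fin 2 × Fin n × Fin n) (residue A)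
    residue_surjective
  let zs : List S := t.toList.map fun f => Λ (lift f)
  let L : List S := entriesList M ++ xs ++ [(p : S)]
  have hpS : (p : S) = MvPowerSeries.C (p : A) := (map_natCast MvPowerSeries.C p).symm
  have hLm : ∀ y ∈ L, y ∈ maximalIdeal S := by
    intro y hy
    rw [List.mem_append, List.mem_append, List.mem_singleton] at hy
    rcases hy with (hy | hy) | rfl
    · obtain ⟨i, j, rfl⟩ := mem_entriesList.1 hy
      have hc : MvPowerSeries.constantCoeff.mapMatrix M = 0 := by
        have hvar (b : Fin (2 * m + 2)) :
            MvPowerSeries.constantCoeff.mapMatrix (varMatrix (A := A) (2 * m + 2) n b) = 0 := by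
          ext i j
          exact MvPowerSeries.constantCoeff_X _
        refine (Matrix.mapMatrix_unipotentConjugation _ _ _ _).trans ?_
        rw [hvar, hvar]
        simp
      rw [MvPowerSeries.mem_maximalIdeal_iff]
      have : MvPowerSeries.constantCoeff (M i j) = 0 := congrFun (congrFun hc i) j
      rw [this]
      exact zero_mem _
    · simp only [hxs, List.mem_flatMap, List.mem_map] at hy
      obtain ⟨b, -, i, -, j, -, rfl⟩ := hy
      rw [MvPowerSeries.mem_maximalIdeal_iff, MvPowerSeries.constantCoeff_X]
      exact zero_mem _
    · rw [hpS, MvPowerSeries.mem_maximalIdeal_iff, MvPowerSeries.constantCoeff_C]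
      exact hpA
  have hzm : ∀ y ∈ zs, y ∈ maximalIdeal S := by
    intro y hy
    obtain ⟨f, hf, rfl⟩ := List.mem_map.1 hy
    rw [MvPowerSeries.mem_maximalIdeal_iff, MvPolynomial.constantCoeff_evalPowerSeriesX,
      ← residue_eq_zero_iff, ← MvPolynomial.constantCoeff_map, hlift]
    exact ht0 f (Finset.mem_toList.1 hf)
  obtain ⟨us, hus, husm, huslen⟩ := MvPowerSeries.exists_isWeaklyRegular (A := A) (ts := [(p : A)])
    (by
      rw [RingTheory.Sequence.isWeaklyRegular_singleton_iff]
      exact fun a b h => mul_left_cancel₀ hp0 h)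
    (by simpa using hpu) (Fin (2 * m + 2) × Fin n × Fin n)
  have hreg := RingTheory.Sequence.IsRegular.of_isWeaklyRegular_of_mem_maximalIdeal S husm hus
  suffices h : RingTheory.Sequence.IsWeaklyRegular S (L ++ zs) from
    RingTheory.Sequence.IsRegular.of_isWeaklyRegular_of_mem_maximalIdeal S hLm
      ((RingTheory.Sequence.isWeaklyRegular_append_iff S L zs).1 h).1
  refine isWeaklyRegular_of_forall_eq_maximalIdeal hreg husm
    (fun y hy => (List.mem_append.1 hy).elim (hLm y) (hzm y)) ?_ fun Q hQ _ hyQ => ?_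
  · have hxlen : xs.length = 2 * m * (n * n) := by
      simp [hxs, List.length_flatMap]
    simp only [L, zs, List.length_append, List.length_map, Finset.length_toList,
      length_entriesList, hxlen, huslen, List.length_singleton, Nat.card_eq_fintype_card,
      Fintype.card_prod, Fintype.card_fin]
    nlinarith
  · have hLQ (y : S) (hy : y ∈ L) : y ∈ Q := hyQ y (List.mem_append_left _ hy)
    have hC : ∀ a ∈ maximalIdeal A, (MvPowerSeries.C a : S) ∈ Q := by
      have hp : (p : S) ∈ Q := hLQ _ (by simp [L])
      rw [hpS] at hp
      have := hpm (Q.comap MvPowerSeries.C) inferInstance hp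
      exact fun a ha => this.ge ha
    obtain ⟨Q', hQ', hiff, hker⟩ := MvPowerSeries.exists_ideal_residueField e hC
    have hX := ht Q' hQ' ?_ ?_ hker
    · refine MvPowerSeries.eq_maximalIdeal_of_forall_X_mem hC fun x => ?_
      obtain ⟨b, i, j⟩ := x
      rcases lt_or_ge b.1 2 with hb | hb
      · have := hX (⟨b.1, hb⟩, i, j)
        rw [← MvPolynomial.map_X (residue A), hiff, MvPolynomial.evalPowerSeriesX_X] at this
        exact this
      · refine hLQ _ (List.mem_append_left _ (List.mem_append_right _ ?_))
        simp only [hxs, List.mem_flatMap, List.mem_map]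
        refine ⟨⟨b.1 - 2, by omega⟩, List.mem_finRange _, i, List.mem_finRange _, j,
          List.mem_finRange _, ?_⟩
        congr 2
        ext
        simp only [Fin.val_addNat]
        omega
    · refine Ideal.span_le.2 ?_
      rintro _ ⟨⟨i, j⟩, rfl⟩
      have h1 : (MvPolynomial.map (residue A)).mapMatrix W =
          (1 + Matrix.of fun i j => MvPolynomial.X (1, i, j)) *
              (1 + Matrix.of fun i j => MvPolynomial.X (0, i, j)) -
            (1 + Matrix.of fun i j => MvPolynomial.X (0, i, j)) ^ (p ^ s + 1) *
              (1 + Matrix.of fun i j => MvPolynomial.X (1, i, j)) := by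
        refine (Matrix.mapMatrix_unipotentConjugation
          (MvPolynomial.map (residue A)) (p ^ s) _ _).trans ?_
        rw [hρ, hρ]
      rw [SetLike.mem_coe, ← h1]
      refine (hiff (W i j)).2 ?_
      have h2 : Λ (W i j) = M i j := congrFun (congrFun hΛW i) j
      have h3 : M i j ∈ Q := hLQ _
        (List.mem_append_left _ (List.mem_append_left _ (mem_entriesList.2 ⟨i, j, rfl⟩)))
      exact h2 ▸ h3
    · intro f hf
      rw [← hlift f, hiff]
      exact hyQ _ (List.mem_append_right _
        (List.mem_map.2 ⟨f, Finset.mem_toList.2 hf, rfl⟩))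

end PowerSeriesRing

/-- In `S = 𝒪_L⟦X_1, …, X_{d+2}⟧` (with `d = 2m`), the `1 + n²(d+1)` elements consisting of
the `n²` entries of `X̃_2 X̃_1 - X̃_1^{q+1} X̃_2`, the `n² d` variables comprising
`X_3, …, X_{d+2}`, and finally `p`, form a regular sequence on `S`. -/
theorem regular_sequence_in_power_series_ring
    (p s q m n : ℕ) (hs : 1 ≤ s) (hq : q = p ^ s) (hq3 : 3 ≤ q)
    (hm : 1 ≤ m) (hn : 1 ≤ n) [Fact p.Prime]
    (L : Type) [Field L] [Algebra ℚ_[p] L] [FiniteDimensional ℚ_[p] L]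
    [Algebra ℤ_[p] L] [IsScalarTower ℤ_[p] ℚ_[p] L] :
    RingTheory.Sequence.IsRegular
      (MvPowerSeries (Fin (2 * m + 2) × Fin n × Fin n) (RingOfIntegers p L))
      (entriesList
          (Xt (A := RingOfIntegers p L) (2 * m + 2) n ⟨1, by omega⟩ *
              Xt (A := RingOfIntegers p L) (2 * m + 2) n ⟨0, by omega⟩ -
            (Xt (A := RingOfIntegers p L) (2 * m + 2) n ⟨0, by omega⟩) ^ (q + 1) *
              Xt (A := RingOfIntegers p L) (2 * m + 2) n ⟨1, by omega⟩) ++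
        ((List.finRange (2 * m)).flatMap fun k =>
          (List.finRange n).flatMap fun i =>
            (List.finRange n).map fun j =>
              (MvPowerSeries.X (k.addNat 2, i, j) :
                MvPowerSeries (Fin (2 * m + 2) × Fin n × Fin n) (RingOfIntegers p L))) ++
        [(p : MvPowerSeries (Fin (2 * m + 2) × Fin n × Fin n) (RingOfIntegers p L))]) := by
  subst hq
  have := isLocalRing_integralClosure_padicInt p L
  have := isNoetherianRing_integralClosure_padicInt p L
  exact MvPowerSeries.isRegular_unipotentConjugation (by omega) hn
    (natCast_ne_zero_integralClosure_padicInt p L) (not_isUnit_natCast_integralClosure_padicInt p L)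
    fun Q _ hp => eq_maximalIdeal_of_natCast_mem_integralClosure_padicInt p L hp
end
end
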